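/- C has only ordinary singularities if and only if X_2(K) consists of exactly (n−1)(n−2)/2 points (equivalently, the scheme X_2, which always has length (n−1)(n−2)/2, is reduced) and no point (x_0:x_1:x_2) of X_2(K) lies on the conic 4x_0x_2 − x_1² = 0. -/

import Mathlib

open MvPolynomial

noncomputable section

/-- The coefficient `a_i` of `s^(n-i) t^i` in a binary form `f` of degree `n`. -/
def bcoeff {K : Type*} [Field K] (n : ℕ) (f : MvPolynomial (Fin 2) K) (i : Fin (n + 1)) : K :=
  MvPolynomial.coeff (Finsupp.single 0 (n - (i : ℕ)) + Finsupp.single 1 (i : ℕ)) f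

/-- The binary form of degree `k` with coefficient vector `x`. -/
def formOf {K : Type*} [Field K] (k : ℕ) (x : Fin (k + 1) → K) : MvPolynomial (Fin 2) K :=
  ∑ i : Fin (k + 1),
    MvPolynomial.C (x i) * MvPolynomial.X 0 ^ (k - (i : ℕ)) * MvPolynomial.X 1 ^ (i : ℕ)

/-- The matrix `M_k` associated to the parameterization `f`: the first `n-k+1` rows contain
the variables `x_0, …, x_k` in staircase position, the last three rows are the coefficient
vectors of `f_0, f_1, f_2`. -/
def Mmat {K : Type*} [Field K] (n k : ℕ) (f : Fin 3 → MvPolynomial (Fin 2) K) :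
    Matrix (Fin (n - k + 4)) (Fin (n + 1)) (MvPolynomial (Fin (k + 1)) K) :=
  fun j c =>
    if hj : (j : ℕ) ≤ n - k then
      if h : (j : ℕ) ≤ (c : ℕ) ∧ (c : ℕ) ≤ (j : ℕ) + k then
        MvPolynomial.X ⟨(c : ℕ) - (j : ℕ), by omega⟩
      else 0
    else
      MvPolynomial.C (bcoeff n (f ⟨(j : ℕ) - (n - k + 1), by have := j.isLt; omega⟩) c)

/-- The set of `(n-k+3) × (n-k+3)` minors of the matrix `M_k`; it generates the ideal
`I_{X_k}`. -/
def minorsSet {K : Type*} [Field K] (n k : ℕ) (f : Fin 3 → MvPolynomial (Fin 2) K) :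
    Set (MvPolynomial (Fin (k + 1)) K) :=
  { g | ∃ (r : Fin (n - k + 3) → Fin (n - k + 4)) (c : Fin (n - k + 3) → Fin (n + 1)),
      Function.Injective r ∧ Function.Injective c ∧
      g = ((Mmat n k f).submatrix r c).det }

/-- The projective zero locus `X_k(K) ⊆ ℙ^k(K)` of the ideal of minors of `M_k`. -/
def XkSet {K : Type*} [Field K] (n k : ℕ) (f : Fin 3 → MvPolynomial (Fin 2) K) :
    Set (Projectivization K (Fin (k + 1) → K)) :=
  { P | ∀ g ∈ minorsSet n k f, MvPolynomial.eval P.rep g = 0 }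

/-- Evaluation of the parameterization at a vector `v ∈ K²`. -/
def evalVec {K : Type*} [Field K] (f : Fin 3 → MvPolynomial (Fin 2) K) (v : Fin 2 → K) :
    Fin 3 → K :=
  fun u => MvPolynomial.eval v (f u)

/-- The induced map `f : ℙ¹(K) → ℙ²(K)` (with a junk value where undefined). -/
def projMap {K : Type*} [Field K] (f : Fin 3 → MvPolynomial (Fin 2) K)
    (P : Projectivization K (Fin 2 → K)) : Projectivization K (Fin 3 → K) :=
  haveI := Classical.propDecidable (evalVec f P.rep ≠ 0)
  if h : evalVec f P.rep ≠ 0 then Projectivization.mk K _ h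
  else Projectivization.mk K (fun _ => 1) (fun hc => one_ne_zero (congrFun hc 0))

/-- `f = (f_0, f_1, f_2)` is a proper parameterization of degree `n`: the `f_u` are
homogeneous of degree `n`, have no common zero outside the origin, and the induced map
`ℙ¹(K) → ℙ²(K)` is injective outside some finite set. -/
structure IsProperParam {K : Type*} [Field K] (n : ℕ)
    (f : Fin 3 → MvPolynomial (Fin 2) K) : Prop where
  homog : ∀ u, (f u).IsHomogeneous n
  no_common_zero : ∀ v : Fin 2 → K, v ≠ 0 → evalVec f v ≠ 0
  gen_injective : ∃ S : Set (Projectivization K (Fin 2 → K)), S.Finite ∧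
    Set.InjOn (projMap f) Sᶜ

/-- The homogeneous vanishing ideal of the point `p ∈ ℙ²(K)`. -/
def pointIdeal {K : Type*} [Field K] (p : Fin 3 → K) : Ideal (MvPolynomial (Fin 3) K) :=
  Ideal.span { L | L.IsHomogeneous 1 ∧ MvPolynomial.eval p L = 0 }

/-- The multiplicity of the curve `{F = 0}` at the point `p`:
the largest `m` with `F ∈ I(p)^m`. -/
def multAt {K : Type*} [Field K] (F : MvPolynomial (Fin 3) K) (p : Fin 3 → K) : ℕ :=
  sSup { m | F ∈ pointIdeal p ^ m }

/-- The cross difference `p_i f_j - p_j f_i`. -/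
def crossDiff {K : Type*} [Field K] (f : Fin 3 → MvPolynomial (Fin 2) K) (p : Fin 3 → K)
    (i j : Fin 3) : MvPolynomial (Fin 2) K :=
  MvPolynomial.C (p i) * f j - MvPolynomial.C (p j) * f i

/-- `G` is a greatest common divisor of the three cross differences `p_i f_j - p_j f_i`,
`0 ≤ i < j ≤ 2`. -/
def IsGcdOfCross {K : Type*} [Field K] (f : Fin 3 → MvPolynomial (Fin 2) K) (p : Fin 3 → K)
    (G : MvPolynomial (Fin 2) K) : Prop :=
  (∀ i j : Fin 3, i < j → G ∣ crossDiff f p i j) ∧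
  (∀ D : MvPolynomial (Fin 2) K, (∀ i j : Fin 3, i < j → D ∣ crossDiff f p i j) → D ∣ G)

/-- The linear binary form with root `v = (v 0 : v 1)`. -/
def linFormOf {K : Type*} [Field K] (v : Fin 2 → K) : MvPolynomial (Fin 2) K :=
  MvPolynomial.C (v 1) * MvPolynomial.X 0 - MvPolynomial.C (v 0) * MvPolynomial.X 1

/-- The multiplicity of `v` as a root of the binary form `h`. -/
def ordAt {K : Type*} [Field K] (v : Fin 2 → K) (h : MvPolynomial (Fin 2) K) : ℕ :=
  sSup { e | linFormOf v ^ e ∣ h }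

/-- The point `x ∈ ℙ²` lies on the conic `4 x₀ x₂ - x₁² = 0`. -/
def onConic {K : Type*} [Field K] (x : Fin 3 → K) : Prop :=
  4 * x 0 * x 2 - x 1 ^ 2 = 0

/-- `C` has only ordinary singularities: for every singular point `P`, the form `G_P` is
squarefree (all branches are smooth) and no two distinct branches of `C` at `P` share a
tangent line (no line meets two distinct preimages of `P` to order `≥ 2`). -/
def OnlyOrdinarySing {K : Type*} [Field K] (f : Fin 3 → MvPolynomial (Fin 2) K)
    (F : MvPolynomial (Fin 3) K) : Prop :=
  ∀ p : Fin 3 → K, p ≠ 0 → 2 ≤ multAt F p →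
    ∀ G : MvPolynomial (Fin 2) K, IsGcdOfCross f p G →
      Squarefree G ∧
      ∀ v w : Fin 2 → K, v ≠ 0 → w ≠ 0 →
        MvPolynomial.eval v G = 0 → MvPolynomial.eval w G = 0 →
        (∀ d : K, w ≠ d • v) →
        ¬ ∃ c : Fin 3 → K, c ≠ 0 ∧
            2 ≤ ordAt v (∑ u : Fin 3, MvPolynomial.C (c u) * f u) ∧
            2 ≤ ordAt w (∑ u : Fin 3, MvPolynomial.C (c u) * f u)

namespace Polynomial
open scoped Matrix
variable {K : Type*} [Field K]

/-- The value at `a` of a vector of univariate polynomials. -/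
def vecEval (φ : Fin 3 → K[X]) (a : K) : Fin 3 → K := fun u => (φ u).eval a

/-- The vector of coefficients of `X ^ m`. -/
def vecCoeff (φ : Fin 3 → K[X]) (m : ℕ) : Fin 3 → K := fun u => (φ u).coeff m

/-- The derivative of a vector of polynomials. -/
def vecDeriv (φ : Fin 3 → K[X]) : Fin 3 → K[X] := fun u => derivative (φ u)

/-- A vector of constants, as a vector of polynomials. -/
def vecC (P : Fin 3 → K) : Fin 3 → K[X] := fun u => C (P u)

theorem exists_eq_smul_of_cross_eq_zero {u w : Fin 3 → K} (hu : u ≠ 0) (h : u ⨯₃ w = 0) :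
    ∃ l : K, w = l • u := by
  have : ¬ LinearIndependent K ![u, w] := by
    rw [← crossProduct_ne_zero_iff_linearIndependent]; simpa using h
  rw [LinearIndependent.pair_iff' hu] at this
  push Not at this
  obtain ⟨l, hl⟩ := this
  exact ⟨l, hl.symm⟩

theorem mul_eq_mul_of_cross_eq_zero {R : Type*} [CommRing R] {p c : Fin 3 → R}
    (h : p ⨯₃ c = 0) (i j : Fin 3) : p i * c j = p j * c i := by
  rw [cross_apply] at h
  have h0 := congrFun h 0
  have h1 := congrFun h 1
  have h2 := congrFun h 2
  simp at h0 h1 h2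
  fin_cases i <;> fin_cases j <;> simp <;> grind

theorem exists_eq_mul_of_cross_eq_zero [IsAlgClosed K] {p c : Fin 3 → K[X]}
    (h : p ⨯₃ c = 0) (hc : ∀ a, vecEval c a ≠ 0) : ∃ k : K[X], ∀ j, p j = k * c j := by
  have htop : Ideal.span (Set.range c) = ⊤ := by
    by_contra hne
    obtain ⟨M, hM, hle⟩ := Ideal.exists_le_maximal _ hne
    obtain ⟨g, rfl⟩ := (IsPrincipalIdealRing.principal M).principal
    have hg : ¬ IsUnit g := fun hu => hM.ne_top (Ideal.span_singleton_eq_top.2 hu)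
    have hd : g.degree ≠ 0 ∨ g = 0 := by
      by_contra hcon
      push Not at hcon
      exact hg (isUnit_iff_degree_eq_zero.2 hcon.1)
    have : ∃ a, g.IsRoot a := by
      rcases hd with hd | hd
      · exact IsAlgClosed.exists_root g hd
      · exact ⟨0, by simp [hd]⟩
    obtain ⟨a, ha⟩ := this
    refine hc a (_root_.funext fun u => ?_)
    have hu : c u ∈ Ideal.span {g} := hle (Ideal.subset_span ⟨u, rfl⟩)
    rw [Ideal.mem_span_singleton] at hu
    exact ha.dvd hu
  obtain ⟨u, hu⟩ := (Ideal.mem_span_range_iff_exists_fun).1 (htop ▸ Submodule.mem_top : (1 : K[X]) ∈ _)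
  refine ⟨∑ i, u i * p i, fun j => ?_⟩
  calc p j = (∑ i, u i * c i) * p j := by rw [hu, one_mul]
    _ = _ := by
      rw [Finset.sum_mul, Finset.sum_mul]
      refine Finset.sum_congr rfl fun i _ => ?_
      linear_combination (- u i) * mul_eq_mul_of_cross_eq_zero h i j

theorem cross_vecC_cross_eq_zero {p φ : Fin 3 → K[X]} {P : Fin 3 → K}
    (h1 : p ⬝ᵥ φ = 0) (h2 : vecC P ⬝ᵥ p = 0) : p ⨯₃ (vecC P ⨯₃ φ) = 0 := by
  rw [cross_cross_eq_smul_sub_smul', h1]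
  simp [h2]

theorem vecEval_cross (φ ψ : Fin 3 → K[X]) (a : K) : vecEval (φ ⨯₃ ψ) a = vecEval φ a ⨯₃ vecEval ψ a := by
  funext u; fin_cases u <;> simp [vecEval, cross_apply]

theorem vecCoeff_vecC_cross (P : Fin 3 → K) (ψ : Fin 3 → K[X]) (m : ℕ) :
    vecCoeff (vecC P ⨯₃ ψ) m = P ⨯₃ vecCoeff ψ m := by
  funext u; fin_cases u <;> simp [vecCoeff, vecC, cross_apply]

theorem vecDeriv_vecC_cross (P : Fin 3 → K) (ψ : Fin 3 → K[X]) :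
    vecDeriv (vecC P ⨯₃ ψ) = vecC P ⨯₃ vecDeriv ψ := by
  funext u; fin_cases u <;> simp [vecDeriv, vecC, cross_apply]

@[simp] theorem vecEval_vecC (P : Fin 3 → K) (a : K) : vecEval (vecC P) a = P := by
  funext u; simp [vecEval, vecC]

theorem eval_dotProduct (φ ψ : Fin 3 → K[X]) (a : K) :
    (φ ⬝ᵥ ψ).eval a = vecEval φ a ⬝ᵥ vecEval ψ a := by
  simp [dotProduct, vecEval, eval_finsetSum]

/-- For a syzygy `p` of `φ`, the polynomial `p(w) · φ(v)` is divisible by `w - v`; the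
coefficients `Φ k` of the quotient as a polynomial in `w`. -/
theorem exists_quotient (N : ℕ) {φ p : Fin 3 → K[X]} (hφ : ∀ u, (φ u).natDegree ≤ N + 2)
    (hp : ∀ u, (p u).natDegree ≤ N) (h : p ⬝ᵥ φ = 0) :
    ∃ Φ : Fin N → K[X], (∀ k, (Φ k).natDegree ≤ N + 1) ∧
      (∀ k, (Φ k).coeff (N + 1) = - (vecCoeff φ (N + 2) ⬝ᵥ vecCoeff p k)) ∧
      ∀ b : K, (C b - X) * ∑ k : Fin N, C (b ^ (k : ℕ)) * Φ k = vecC (vecEval p b) ⬝ᵥ φ := by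
  set g : ℕ → K[X] := fun i => vecC (vecCoeff p i) ⬝ᵥ φ with hg
  have hgdeg : ∀ i, (g i).natDegree ≤ N + 2 := fun i => by
    simp only [hg, dotProduct]
    refine natDegree_sum_le_of_forall_le _ _ fun u _ => ?_
    exact (natDegree_C_mul_le _ _).trans (hφ u)
  have hgc : ∀ i, (g i).coeff (N + 2) = vecCoeff φ (N + 2) ⬝ᵥ vecCoeff p i := fun i => by
    simp only [hg, dotProduct, finsetSum_coeff, vecC, coeff_C_mul, vecCoeff]
    exact Finset.sum_congr rfl fun u _ => mul_comm _ _
  have hsum : ∀ q : K[X], (∑ i ∈ Finset.range (N + 1), g i * q ^ i) =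
      ∑ u, (p u).comp q * φ u := fun q => by
    simp only [hg, dotProduct, Finset.sum_mul, vecC, vecCoeff]
    rw [Finset.sum_comm]
    refine Finset.sum_congr rfl fun u _ => ?_
    rw [comp, eval₂_eq_sum_range' C (Nat.lt_succ_of_le (hp u)), Finset.sum_mul]
    exact Finset.sum_congr rfl fun i _ => by ring
  set Ψ : ℕ → K[X] := fun k => ∑ i ∈ Finset.Ico k (N + 1), g i * X ^ (i - k) with hΨ
  have hΨ0 : Ψ 0 = 0 := by
    have := hsum X
    simp only [comp_X] at this
    simp only [hΨ, ← Finset.range_eq_Ico, Nat.sub_zero]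
    rw [this]; exact h
  have hrec : ∀ k, k ≤ N → X * Ψ (k + 1) = Ψ k - g k := fun k hk => by
    simp only [hΨ]
    rw [Finset.sum_eq_sum_Ico_succ_bot (show k < N + 1 by omega)]
    simp only [Nat.sub_self, pow_zero, mul_one, add_sub_cancel_left, Finset.mul_sum]
    refine Finset.sum_congr rfl fun i hi => ?_
    rw [Finset.mem_Ico] at hi
    rw [show i - k = (i - (k + 1)) + 1 by omega, pow_succ]; ring
  have hdeg : ∀ k, k ≤ N → (Ψ k).natDegree ≤ N + 1 ∧
      (∀ k', k' + 1 = k → (Ψ k).coeff (N + 1) = - (g k').coeff (N + 2)) := by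
    intro k
    induction k with
    | zero => intro _; simp [hΨ0]
    | succ k ih =>
      intro hk
      have ih := ih (by omega)
      have hr := hrec k (by omega)
      have hc : ∀ m, (Ψ (k + 1)).coeff m = (Ψ k).coeff (m + 1) - (g k).coeff (m + 1) := by
        intro m
        rw [← coeff_sub, ← hr, coeff_X_mul]
      constructor
      · rw [natDegree_le_iff_coeff_eq_zero]
        intro m hm
        rw [hc, coeff_eq_zero_of_natDegree_lt (by omega),
          coeff_eq_zero_of_natDegree_lt (lt_of_le_of_lt (hgdeg k) (by omega)), sub_zero]
      · rintro k' hk'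
        obtain rfl : k' = k := by omega
        rw [hc, coeff_eq_zero_of_natDegree_lt (by omega), zero_sub]
  refine ⟨fun k => Ψ (k + 1), fun k => (hdeg _ k.2).1, fun k => ?_, fun b => ?_⟩
  · rw [(hdeg _ k.2).2 k rfl, hgc]
  · have key : ∀ M, M ≤ N → (C b - X) * ∑ k ∈ Finset.range M, C (b ^ k) * Ψ (k + 1) =
        C (b ^ M) * Ψ M + ∑ k ∈ Finset.range M, C (b ^ k) * g k := by
      intro M
      induction M with
      | zero => simp [hΨ0]
      | succ M ih =>
        intro hM
        rw [Finset.sum_range_succ, mul_add, ih (by omega), Finset.sum_range_succ]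
        have := hrec M (by omega)
        rw [pow_succ, C_mul]
        linear_combination (- C (b ^ M)) * this
    rw [Finset.sum_range (fun k => C (b ^ k) * Ψ (k + 1)) |>.symm, key N le_rfl]
    have h1 := hsum (C b)
    rw [Finset.sum_range_succ] at h1
    have h2 : Ψ N = g N := by simp [hΨ]
    rw [h2]
    simp only [comp_C, ← C_pow] at h1
    rw [show vecC (vecEval p b) ⬝ᵥ φ = ∑ u, C ((p u).eval b) * φ u from rfl, ← h1]
    rw [add_comm, mul_comm]
    congr 1
    exact Finset.sum_congr rfl fun i _ => mul_comm _ _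

/-- Parameterizations in an affine chart for which the point at infinity is the only point in
its fibre and the parameterization is an immersion everywhere, including at infinity. -/
structure IsImmersedChart (N : ℕ) (φ : Fin 3 → K[X]) : Prop where
  natDegree_le : ∀ u, (φ u).natDegree ≤ N + 2
  cross_infty : ∀ a, vecCoeff φ (N + 2) ⨯₃ vecEval φ a ≠ 0
  cross_coeff : vecCoeff φ (N + 2) ⨯₃ vecCoeff φ (N + 1) ≠ 0
  cross_deriv : ∀ a, vecEval φ a ⨯₃ vecEval (vecDeriv φ) a ≠ 0
  nondegenerate : ∀ c : Fin 3 → K, vecC c ⬝ᵥ φ = 0 → c = 0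

theorem exists_syzygies_of_le_finrank (N : ℕ) (φ : Fin 3 → K[X])
    (hφ : ∀ u, (φ u).natDegree ≤ N + 2)
    (hinj : ∀ p : Fin 3 → K[X], (∀ u, (p u).natDegree ≤ N) → p ⬝ᵥ φ = 0 →
      (∀ k < N, vecCoeff φ (N + 2) ⬝ᵥ vecCoeff p k = 0) → p = 0) :
    ∃ z : Fin N → Fin 3 → K[X], (∀ j u, (z j u).natDegree ≤ N) ∧ (∀ j, z j ⬝ᵥ φ = 0) ∧
      (∀ x : Fin N → K, ∑ j, x j • z j = 0 → x = 0) ∧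
      (∀ p : Fin 3 → K[X], (∀ u, (p u).natDegree ≤ N) → p ⬝ᵥ φ = 0 →
        ∃ x : Fin N → K, p = ∑ j, x j • z j) := by
  let P : (Fin (N + 1) → K) →ₗ[K] K[X] := Fintype.linearCombination K fun i => X ^ (i : ℕ)
  have hPdef : ∀ x, P x = ∑ i : Fin (N + 1), C (x i) * X ^ (i : ℕ) := fun x => by
    simp [P, Fintype.linearCombination_apply, smul_eq_C_mul]
  have hPdeg : ∀ x, (P x).natDegree ≤ N := fun x => by
    rw [hPdef]
    refine natDegree_sum_le_of_forall_le _ _ fun i _ => ?_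
    exact (natDegree_C_mul_X_pow_le _ _).trans (Nat.lt_succ_iff.1 i.2)
  have hPsurj : ∀ q : K[X], q.natDegree ≤ N → P (fun i => q.coeff i) = q := fun q hq => by
    rw [hPdef, Finset.sum_fin_eq_sum_range]
    conv_rhs => rw [q.as_sum_range_C_mul_X_pow' (Nat.lt_succ_of_le hq)]
    refine Finset.sum_congr rfl fun i hi => ?_
    simp [Finset.mem_range.1 hi]
  have hPinj : ∀ x, P x = 0 → x = 0 := fun x hx => by
    ext i
    have := congrArg (fun q => q.coeff (i : ℕ)) hx
    rw [hPdef] at this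
    simpa [finsetSum_coeff, coeff_X_pow, Fin.val_inj] using this
  let Q : (Fin 3 → Fin (N + 1) → K) →ₗ[K] (Fin 3 → K[X]) := LinearMap.pi fun u => P ∘ₗ LinearMap.proj u
  have hQ : ∀ x u, Q x u = P (x u) := fun x u => rfl
  have hQinj : ∀ x, Q x = 0 → x = 0 := fun x hx =>
    _root_.funext fun u => hPinj _ (congrFun hx u)
  let T : (Fin 3 → Fin (N + 1) → K) →ₗ[K] (Fin (2 * N + 3) → K) :=
    LinearMap.pi fun k => lcoeff K k ∘ₗ ∑ u, LinearMap.mulRight K (φ u) ∘ₗ P ∘ₗ LinearMap.proj u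
  have hT : ∀ x, T x = 0 ↔ Q x ⬝ᵥ φ = 0 := fun x => by
    have hTk : ∀ k, T x k = (Q x ⬝ᵥ φ).coeff k := fun k => by simp [T, hQ, dotProduct]
    constructor
    · intro h
      ext k
      by_cases hk : k < 2 * N + 3
      · rw [← hTk ⟨k, hk⟩, h]; simp
      · rw [coeff_zero]
        refine coeff_eq_zero_of_natDegree_lt (lt_of_le_of_lt (b := N + (N + 2)) ?_ (by omega))
        refine natDegree_sum_le_of_forall_le _ _ fun u _ => natDegree_mul_le.trans ?_
        exact add_le_add (hPdeg _) (hφ u)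
    · intro h
      ext k
      rw [hTk, h]; simp
  let ι : (Fin 3 → Fin (N + 1) → K) →ₗ[K] (Fin N → K) :=
    LinearMap.pi fun k => ∑ u, (φ u).coeff (N + 2) • (lcoeff K k ∘ₗ P ∘ₗ LinearMap.proj u)
  have hι : ∀ x k, ι x k = vecCoeff φ (N + 2) ⬝ᵥ vecCoeff (Q x) k := fun x k => by
    simp [ι, dotProduct, vecCoeff, hQ]
  have hιinj : Function.Injective (ι ∘ₗ (LinearMap.ker T).subtype) := by
    refine (injective_iff_map_eq_zero _).2 fun x hx => Subtype.ext (hQinj _ ?_)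
    refine hinj _ (fun u => hPdeg _) ((hT _).1 x.2) fun k hk => ?_
    rw [← hι _ ⟨k, hk⟩]
    exact congrFun hx ⟨k, hk⟩
  have hfin : Module.finrank K (LinearMap.ker T) = N := by
    apply le_antisymm
    · simpa using LinearMap.finrank_le_finrank_of_injective hιinj
    · have h1 := LinearMap.finrank_range_add_finrank_ker T
      have h2 := (LinearMap.range T).finrank_le
      rw [Module.finrank_pi_fintype] at h1
      simp at h1 h2
      omega
  let B := Module.finBasisOfFinrankEq K (LinearMap.ker T) hfin
  refine ⟨fun j => Q (B j), fun j u => hPdeg _, fun j => (hT _).1 (B j).2,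
    fun x hx => ?_, fun p hp hpφ => ?_⟩
  · have h1 : Q ((∑ j, x j • B j : LinearMap.ker T) : Fin 3 → Fin (N + 1) → K) = 0 := by
      simpa using hx
    have h0 : ∑ j, x j • B j = 0 := Subtype.ext (hQinj _ h1)
    exact _root_.funext fun j => Fintype.linearIndependent_iff.1 B.linearIndependent x h0 j
  · have hQp : Q (fun u i => (p u).coeff i) = p := _root_.funext fun u => hPsurj _ (hp u)
    let p' : LinearMap.ker T := ⟨fun u i => (p u).coeff i, (hT _).2 (by rw [hQp, hpφ])⟩
    refine ⟨B.repr p', ?_⟩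
    have h1 : Q (p' : Fin 3 → Fin (N + 1) → K) = p := hQp
    have h2 := congrArg (fun y : LinearMap.ker T => Q (y : Fin 3 → Fin (N + 1) → K)) (B.sum_repr p')
    simp only [Submodule.coe_sum, Submodule.coe_smul, map_sum, map_smul, h1] at h2
    exact h2.symm

theorem vecCoeff_mul_top {N : ℕ} {φ p : Fin 3 → K[X]} (hφ : ∀ u, (φ u).natDegree ≤ N + 2)
    (hp : ∀ u, (p u).natDegree ≤ N) (h : p ⬝ᵥ φ = 0) :
    vecCoeff φ (N + 2) ⬝ᵥ vecCoeff p N = 0 := by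
  have := congrArg (fun q => q.coeff (N + (N + 2))) h
  simp only [dotProduct, finsetSum_coeff, coeff_zero] at this
  rw [← this]
  refine Finset.sum_congr rfl fun u _ => ?_
  rw [coeff_mul_add_eq_of_natDegree_le (hp u) (hφ u), mul_comm]; rfl

theorem IsImmersedChart.exists_syzygies [IsAlgClosed K] {N : ℕ} {φ : Fin 3 → K[X]}
    (h : IsImmersedChart N φ) :
    ∃ z : Fin N → Fin 3 → K[X], (∀ j u, (z j u).natDegree ≤ N) ∧ (∀ j, z j ⬝ᵥ φ = 0) ∧
      (∀ p : Fin 3 → K[X], (∀ u, (p u).natDegree ≤ N) → p ⬝ᵥ φ = 0 →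
        ∃ x : Fin N → K, p = ∑ j, x j • z j) ∧
      (∀ x : Fin N → K, ∑ j, x j • z j = 0 → x = 0) ∧
      (Matrix.of fun k j : Fin N => vecCoeff φ (N + 2) ⬝ᵥ vecCoeff (z j) k).det ≠ 0 := by
  have hinj : ∀ p : Fin 3 → K[X], (∀ u, (p u).natDegree ≤ N) → p ⬝ᵥ φ = 0 →
      (∀ k < N, vecCoeff φ (N + 2) ⬝ᵥ vecCoeff p k = 0) → p = 0 := by
    intro p hp hpφ hk
    have h0 : vecC (vecCoeff φ (N + 2)) ⬝ᵥ p = 0 := by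
      ext k
      simp only [dotProduct, finsetSum_coeff, vecC, coeff_C_mul, coeff_zero]
      rcases lt_trichotomy k N with hlt | rfl | hgt
      · exact hk k hlt
      · exact vecCoeff_mul_top h.natDegree_le hp hpφ
      · refine Finset.sum_eq_zero fun u _ => ?_
        rw [coeff_eq_zero_of_natDegree_lt (lt_of_le_of_lt (hp u) hgt), mul_zero]
    obtain ⟨k, hkc⟩ := exists_eq_mul_of_cross_eq_zero (cross_vecC_cross_eq_zero hpφ h0) (fun a => by
      rw [vecEval_cross, vecEval_vecC]; exact h.cross_infty a)
    have hcf : vecCoeff (vecC (vecCoeff φ (N + 2)) ⨯₃ φ) (N + 1) ≠ 0 := by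
      rw [vecCoeff_vecC_cross]; exact h.cross_coeff
    obtain ⟨i, hi⟩ := Function.ne_iff.1 hcf
    have hk0 : k = 0 := by
      by_contra hk0
      have hne : (vecC (vecCoeff φ (N + 2)) ⨯₃ φ) i ≠ 0 := fun h0 => hi (by simp [vecCoeff, h0])
      have h1 := natDegree_mul hk0 hne
      rw [← hkc] at h1
      have h2 := le_natDegree_of_ne_zero (p := (vecC (vecCoeff φ (N + 2)) ⨯₃ φ) i) hi
      have := hp i
      omega
    exact _root_.funext fun j => by rw [hkc j, hk0]; simp
  obtain ⟨z, hz1, hz2, hz3, hz4⟩ := exists_syzygies_of_le_finrank N φ h.natDegree_le hinj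
  refine ⟨z, hz1, hz2, hz4, hz3, fun hdet => ?_⟩
  obtain ⟨x, hx0, hx⟩ := Matrix.exists_mulVec_eq_zero_iff.2 hdet
  refine hx0 (hz3 x (hinj _ (fun u => ?_) ?_ fun k hk => ?_))
  · rw [Finset.sum_apply]
    exact natDegree_sum_le_of_forall_le _ _ fun j _ => (natDegree_smul_le _ _).trans (hz1 j u)
  · simp [sum_dotProduct, smul_dotProduct, hz2]
  · have := congrFun hx ⟨k, hk⟩
    simp only [Matrix.mulVec, dotProduct, Matrix.of_apply, Pi.zero_apply] at this
    rw [← this]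
    simp only [dotProduct, vecCoeff, Finset.sum_apply, finsetSum_coeff, Pi.smul_apply, coeff_smul,
      smul_eq_mul, Finset.mul_sum, Finset.sum_mul]
    rw [Finset.sum_comm]
    refine Finset.sum_congr rfl fun j _ => Finset.sum_congr rfl fun u _ => by ring

theorem cross_vecC_natDegree_le {m : ℕ} {φ : Fin 3 → K[X]} (hφ : ∀ u, (φ u).natDegree ≤ m)
    (P : Fin 3 → K) (u : Fin 3) : ((vecC P ⨯₃ φ) u).natDegree ≤ m := by
  have key : ∀ i j (x y : K), (C x * φ i - C y * φ j).natDegree ≤ m := fun i j x y =>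
    (natDegree_sub_le _ _).trans (max_le ((natDegree_C_mul_le _ _).trans (hφ i))
      ((natDegree_C_mul_le _ _).trans (hφ j)))
  fin_cases u <;> simp only [cross_apply, vecC] <;> exact key _ _ _ _

/-- The other points of the fibre of `a`, and the primitive syzygy `c` attached to the image
point of `a`. -/
theorem IsImmersedChart.exists_fibre_syzygy {N : ℕ} {φ : Fin 3 → K[X]} (h : IsImmersedChart N φ)
    (a : K) :
    ∃ (W : Finset K) (c : Fin 3 → K[X]),
      (∀ b, b ∈ W ↔ b ≠ a ∧ vecEval φ a ⨯₃ vecEval φ b = 0) ∧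
      W.card ≤ N ∧
      (∀ w, vecEval c w ≠ 0) ∧
      (∀ u, (c u).natDegree + W.card ≤ N + 1) ∧
      (∃ i, c i ≠ 0 ∧ (c i).natDegree + W.card = N + 1) ∧
      c ⬝ᵥ φ = 0 ∧ vecC (vecEval φ a) ⬝ᵥ c = 0 ∧
      (∀ p, p ⬝ᵥ φ = 0 → vecC (vecEval φ a) ⬝ᵥ p = 0 → p ⨯₃ c = 0) ∧
      (∀ b ∈ W, ∃ g : K, g ≠ 0 ∧ vecEval φ a ⨯₃ vecEval (vecDeriv φ) b = g • vecEval c b) := by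
  classical
  set ψ : Fin 3 → K[X] := vecC (vecEval φ a) ⨯₃ φ with hψ
  have hψev : ∀ w, vecEval ψ w = vecEval φ a ⨯₃ vecEval φ w := fun w => by
    rw [hψ, vecEval_cross, vecEval_vecC]
  have hψtop : vecCoeff ψ (N + 2) ≠ 0 := by
    rw [hψ, vecCoeff_vecC_cross, ← cross_anticomm, neg_ne_zero]
    exact h.cross_infty a
  obtain ⟨i, hi⟩ := Function.ne_iff.1 hψtop
  have hψdeg : ∀ u, (ψ u).natDegree ≤ N + 2 := cross_vecC_natDegree_le h.natDegree_le _
  have hψi : ψ i ≠ 0 := fun h0 => hi (by simp [vecCoeff, h0])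
  have hψideg : (ψ i).natDegree = N + 2 := le_antisymm (hψdeg i) (le_natDegree_of_ne_zero hi)
  set Z : Finset K := (ψ i).roots.toFinset.filter fun b => vecEval φ a ⨯₃ vecEval φ b = 0 with hZ
  have hmemZ : ∀ b, b ∈ Z ↔ vecEval φ a ⨯₃ vecEval φ b = 0 := fun b => by
    simp only [hZ, Finset.mem_filter, Multiset.mem_toFinset, mem_roots hψi, and_iff_right_iff_imp]
    intro hb
    rw [← hψev] at hb
    exact congrFun hb i
  have haZ : a ∈ Z := by simp [hmemZ]
  set G : K[X] := ∏ b ∈ Z, (X - C b) with hG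
  have hGmonic : G.Monic := monic_prod_of_monic _ _ fun b _ => monic_X_sub_C b
  have hGdeg : G.natDegree = Z.card := by simp [hG]
  have hdvd : ∀ u, G ∣ ψ u := fun u => by
    refine Finset.prod_dvd_of_coprime (fun x _ y _ hxy => pairwise_coprime_X_sub_C
      Function.injective_id hxy) fun b hb => ?_
    rw [dvd_iff_isRoot]
    have := (hmemZ b).1 hb
    rw [← hψev] at this
    exact congrFun this u
  choose c hc using hdvd
  have hψc : ψ = G • c := _root_.funext hc
  have hφ0 : ∀ w, vecEval φ w ≠ 0 := fun w h0 => h.cross_deriv w (by simp [h0])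
  have hderiv : ∀ b ∈ Z, vecEval φ a ⨯₃ vecEval (vecDeriv φ) b =
      (derivative G).eval b • vecEval c b := fun b hb => by
    have hGb : G.eval b = 0 := by
      rw [hG, eval_prod]; exact Finset.prod_eq_zero hb (by simp)
    rw [← vecEval_vecC (vecEval φ a) b, ← vecEval_cross, ← vecDeriv_vecC_cross, ← hψ]
    funext u
    simp [vecEval, vecDeriv, hc u, hGb]
  have hne : ∀ b ∈ Z, vecEval φ a ⨯₃ vecEval (vecDeriv φ) b ≠ 0 := fun b hb h0 => by
    obtain ⟨l, hl⟩ := exists_eq_smul_of_cross_eq_zero (hφ0 a) ((hmemZ b).1 hb)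
    apply h.cross_deriv b
    rw [hl, LinearMap.map_smul₂, h0, smul_zero]
  have hc0 : ∀ w, vecEval c w ≠ 0 := fun w h0 => by
    by_cases hw : w ∈ Z
    · exact hne w hw (by rw [hderiv w hw, h0, smul_zero])
    · apply hw
      rw [hmemZ, ← hψev]
      funext u
      have := congrFun h0 u
      simp only [vecEval, Pi.zero_apply] at this
      simp [vecEval, hc u, this]
  have hcφ : c ⬝ᵥ φ = 0 := by
    have : ψ ⬝ᵥ φ = 0 := by
      rw [hψ, dotProduct_comm]; exact dot_cross_self _ _
    rw [hψc, smul_dotProduct, smul_eq_mul] at this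
    exact (mul_eq_zero.1 this).resolve_left hGmonic.ne_zero
  have hcP : vecC (vecEval φ a) ⬝ᵥ c = 0 := by
    have : vecC (vecEval φ a) ⬝ᵥ ψ = 0 := dot_self_cross _ _
    rw [hψc, dotProduct_smul, smul_eq_mul] at this
    exact (mul_eq_zero.1 this).resolve_left hGmonic.ne_zero
  have hcard : (Z.erase a).card + 1 = Z.card := Finset.card_erase_add_one haZ
  have hci : c i ≠ 0 := fun h0 => hψi (by rw [hc i, h0, mul_zero])
  have hcideg : Z.card + (c i).natDegree = N + 2 := by
    rw [← hψideg, hc i, natDegree_mul hGmonic.ne_zero hci, hGdeg]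
  have hcdeg : ∀ u, (c u).natDegree + (Z.erase a).card ≤ N + 1 := fun u => by
    by_cases hu : c u = 0
    · rw [hu, natDegree_zero]; omega
    · have := hψdeg u
      rw [hc u, natDegree_mul hGmonic.ne_zero hu, hGdeg] at this
      omega
  refine ⟨Z.erase a, c, fun b => by rw [Finset.mem_erase, hmemZ], ?_, hc0, hcdeg,
    ⟨i, hci, by omega⟩, hcφ, hcP, fun p hp1 hp2 => ?_, fun b hb => ?_⟩
  · by_contra hlt
    have hconst : c = vecC (vecCoeff c 0) := _root_.funext fun u =>
      eq_C_of_natDegree_eq_zero (by have := hcdeg u; omega)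
    have := h.nondegenerate _ (hconst ▸ hcφ)
    apply hc0 0
    rw [hconst, this]
    simp
  · have := cross_vecC_cross_eq_zero hp1 hp2
    rw [← hψ, hψc, map_smul] at this
    exact (smul_eq_zero.1 this).resolve_left hGmonic.ne_zero
  · have hbZ := Finset.mem_of_mem_erase hb
    refine ⟨_, fun h0 => hne b hbZ ?_, hderiv b hbZ⟩
    rw [hderiv b hbZ, h0, zero_smul]

theorem exists_injective_fin_range_superset {α : Type*} [Infinite α] {N : ℕ} (W : Finset α) (a : α)
    (haW : a ∉ W) (hW : W.card ≤ N) :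
    ∃ β : Fin N → α, Function.Injective β ∧ (∀ i, β i ≠ a) ∧ ∀ b ∈ W, ∃ i, β i = b := by
  classical
  obtain ⟨B, hB, hcard⟩ := Infinite.exists_superset_card_eq (insert a W) (N + 1)
    (by rw [Finset.card_insert_of_notMem haW]; omega)
  have haB : a ∈ B := hB (Finset.mem_insert_self _ _)
  have hc : (B.erase a).card = N := by rw [Finset.card_erase_of_mem haB, hcard]; rfl
  let e := (B.erase a).equivFinOfCardEq hc
  refine ⟨fun i => e.symm i, Subtype.val_injective.comp e.symm.injective,
    fun i => (Finset.mem_erase.1 (e.symm i).2).1, fun b hb => ?_⟩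
  have : b ∈ B.erase a := Finset.mem_erase.2 ⟨fun h => haW (h ▸ hb), hB (Finset.mem_insert_of_mem hb)⟩
  exact ⟨e ⟨b, this⟩, by simp⟩

theorem sum_smul_natDegree_le {N : ℕ} {z : Fin N → Fin 3 → K[X]}
    (hz : ∀ j u, (z j u).natDegree ≤ N) (x : Fin N → K) (u : Fin 3) :
    ((∑ j, x j • z j) u).natDegree ≤ N := by
  rw [Finset.sum_apply]
  exact natDegree_sum_le_of_forall_le _ _ fun j _ => (natDegree_smul_le _ _).trans (hz j u)

theorem vecEval_sum_smul {N : ℕ} (z : Fin N → Fin 3 → K[X]) (x : Fin N → K) (b : K) :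
    vecEval (∑ j, x j • z j) b = ∑ j, x j • vecEval (z j) b := by
  funext u; simp [vecEval, Finset.sum_apply, eval_finsetSum]

theorem vecEval_eq_mul {p c : Fin 3 → K[X]} {k : K[X]} (h : ∀ j, p j = k * c j) (b : K) :
    vecEval p b = k.eval b • vecEval c b := by
  funext u; simp [vecEval, h]

/-- The root multiplicity of the determinant of the coefficient matrix of the quotients
`z_j(w) · φ(v) / (w - v)` at `a` counts the other points of the fibre of `a`, with equality
exactly when all branches through the image of `a` are transversal to the one at `a`. -/
theorem IsImmersedChart.rootMultiplicity_det [IsAlgClosed K] {N : ℕ} {φ : Fin 3 → K[X]}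
    (h : IsImmersedChart N φ) {z : Fin N → Fin 3 → K[X]}
    (hzdeg : ∀ j u, (z j u).natDegree ≤ N) (hzφ : ∀ j, z j ⬝ᵥ φ = 0)
    (hzspan : ∀ p : Fin 3 → K[X], (∀ u, (p u).natDegree ≤ N) → p ⬝ᵥ φ = 0 →
      ∃ x : Fin N → K, p = ∑ j, x j • z j)
    (hzind : ∀ x : Fin N → K, ∑ j, x j • z j = 0 → x = 0)
    {A : Matrix (Fin N) (Fin N) K[X]} (hA : A.det ≠ 0)
    (hAz : ∀ j b, (C b - X) * ∑ k : Fin N, C (b ^ (k : ℕ)) * A k j =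
      vecC (vecEval (z j) b) ⬝ᵥ φ) (a : K) :
    ∃ W : Finset K, (∀ b, b ∈ W ↔ b ≠ a ∧ vecEval φ a ⨯₃ vecEval φ b = 0) ∧
      W.card ≤ A.det.rootMultiplicity a ∧
      (W.card = A.det.rootMultiplicity a ↔ ∀ b ∈ W,
        (vecEval φ a ⨯₃ vecEval (vecDeriv φ) b) ⬝ᵥ vecEval (vecDeriv φ) a ≠ 0) := by
  classical
  obtain ⟨W, c, hW, hWN, hc0, hcdeg, ⟨i₀, hci, hcideg⟩, hcφ, hcP, hpc, hWc⟩ :=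
    h.exists_fibre_syzygy a
  refine ⟨W, hW, ?_⟩
  have haW : a ∉ W := fun ha => ((hW a).1 ha).1 rfl
  obtain ⟨β, hβ, hβa, hβW⟩ := exists_injective_fin_range_superset W a haW hWN
  have hφ0 : ∀ w, vecEval φ w ≠ 0 := fun w h0 => h.cross_deriv w (by simp [h0])
  -- syzygies evaluated at a point of the fibre annihilate `φ(a)`
  have hdot : ∀ p : Fin 3 → K[X], p ⬝ᵥ φ = 0 → ∀ b ∈ insert a W,
      vecEval p b ⬝ᵥ vecEval φ a = 0 := by
    intro p hp b hb
    have h1 : ∀ w, vecEval p w ⬝ᵥ vecEval φ w = 0 := fun w => by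
      rw [← eval_dotProduct, hp, eval_zero]
    rcases Finset.mem_insert.1 hb with rfl | hb
    · exact h1 _
    · have h2 := ((hW b).1 hb).2
      rw [← cross_anticomm, neg_eq_zero] at h2
      obtain ⟨l, hl⟩ := exists_eq_smul_of_cross_eq_zero (hφ0 b) h2
      rw [hl, dotProduct_smul, h1, smul_zero]
  set V : Matrix (Fin N) (Fin N) K := Matrix.vandermonde β with hV
  have hVdet : V.det ≠ 0 := Matrix.det_vandermonde_ne_zero_iff.2 hβ
  set M : Matrix (Fin N) (Fin N) K[X] := V.map C * A with hM
  have hMz : ∀ i j, (C (β i) - X) * M i j = vecC (vecEval (z j) (β i)) ⬝ᵥ φ := fun i j => by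
    rw [← hAz, hM, Matrix.mul_apply]; rfl
  have hroot : ∀ i j, β i ∈ W → (X - C a) ∣ M i j := fun i j hi => by
    rw [dvd_iff_isRoot]
    have h1 := congrArg (eval a) (hMz i j)
    rw [eval_dotProduct, vecEval_vecC, hdot _ (hzφ j) _ (Finset.mem_insert_of_mem hi)] at h1
    simp only [eval_mul, eval_sub, eval_C, eval_X] at h1
    exact (mul_eq_zero.1 h1).resolve_left (sub_ne_zero.2 (hβa i))
  choose! R hR using hroot
  set A' : Matrix (Fin N) (Fin N) K[X] := fun i j => if β i ∈ W then R i j else M i j with hA'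
  have hMA' : M = Matrix.of fun i j => (if β i ∈ W then X - C a else 1) * A' i j := by
    ext1 i j
    by_cases hi : β i ∈ W
    · simp [hA', hi, hR i j hi]
    · simp [hA', hi]
  have hcardW : (Finset.univ.filter fun i => β i ∈ W).card = W.card := by
    rw [← Finset.card_image_of_injective _ hβ]
    congr 1
    ext b
    simp only [Finset.mem_image, Finset.mem_filter, Finset.mem_univ, true_and]
    constructor
    · rintro ⟨i, hi, rfl⟩; exact hi
    · intro hb
      obtain ⟨i, rfl⟩ := hβW b hb
      exact ⟨i, hb, rfl⟩
  have hdetM : C V.det * A.det = (X - C a) ^ W.card * A'.det := by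
    have h1 : M.det = C V.det * A.det := by
      rw [hM, Matrix.det_mul, ← RingHom.mapMatrix_apply, ← RingHom.map_det]
    have h2 : M.det = (X - C a) ^ W.card * A'.det := by
      conv_lhs => rw [hMA']
      rw [Matrix.det_mul_column, Finset.prod_ite, Finset.prod_const, Finset.prod_const_one, mul_one, hcardW]
    rw [← h1, h2]
  have hA'0 : A'.det ≠ 0 := fun h0 => by
    rw [h0, mul_zero] at hdetM
    exact mul_ne_zero (C_ne_zero.2 hVdet) hA hdetM
  have hmult : A.det.rootMultiplicity a = W.card + A'.det.rootMultiplicity a := by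
    have h1 := congrArg (rootMultiplicity a) hdetM
    rw [rootMultiplicity_mul (mul_ne_zero (C_ne_zero.2 hVdet) hA),
      rootMultiplicity_mul (mul_ne_zero (pow_ne_zero _ (X_sub_C_ne_zero a)) hA'0),
      rootMultiplicity_C, zero_add, rootMultiplicity_X_sub_C_pow] at h1
    exact h1
  refine ⟨by omega, ?_⟩
  have hiff : W.card = A.det.rootMultiplicity a ↔ A'.det.eval a ≠ 0 := by
    rw [hmult, left_eq_add, rootMultiplicity_eq_zero_iff]
    simp [hA'0, IsRoot]
  rw [hiff]
  set A₀ : Matrix (Fin N) (Fin N) K := A'.map (eval a) with hA₀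
  have hdet₀ : A'.det.eval a = A₀.det := by
    rw [← coe_evalRingHom, RingHom.map_det]; rfl
  rw [hdet₀]
  have hentry : ∀ i j, (β i - a) * A₀ i j = vecEval (z j) (β i) ⬝ᵥ
      (if β i ∈ W then vecEval (vecDeriv φ) a else vecEval φ a) := fun i j => by
    by_cases hi : β i ∈ W
    · have h0 : A₀ i j = (R i j).eval a := by
        rw [hA₀, Matrix.map_apply]; simp only [hA', if_pos hi]
      rw [h0, if_pos hi]
      have h1 := hMz i j
      rw [hR i j hi] at h1
      have h2 := congrArg (fun q => (derivative q).eval a) h1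
      simp only [dotProduct, vecC, derivative_mul, derivative_sub, derivative_C, derivative_X,
        derivative_sum, eval_add, eval_mul, eval_sub, eval_C, eval_X, eval_zero, eval_one, sub_self,
        eval_finsetSum, zero_mul, mul_zero, zero_add, add_zero, sub_zero, one_mul] at h2
      exact h2
    · have h0 : A₀ i j = (M i j).eval a := by
        rw [hA₀, Matrix.map_apply]; simp only [hA', if_neg hi]
      rw [h0, if_neg hi]
      have h1 := congrArg (eval a) (hMz i j)
      rw [eval_dotProduct, vecEval_vecC] at h1
      simpa using h1
  have hmulVec : ∀ x i, (β i - a) * (A₀ *ᵥ x) i = vecEval (∑ j, x j • z j) (β i) ⬝ᵥ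
      (if β i ∈ W then vecEval (vecDeriv φ) a else vecEval φ a) := fun x i => by
    rw [vecEval_sum_smul, sum_dotProduct, Matrix.mulVec, dotProduct, Finset.mul_sum]
    refine Finset.sum_congr rfl fun j _ => ?_
    rw [smul_dotProduct, ← hentry, smul_eq_mul]; ring
  constructor
  · intro hdet b₀ hb₀ htr
    obtain ⟨g, hg, hgc⟩ := hWc b₀ hb₀
    have hcb : vecEval c b₀ ⬝ᵥ vecEval (vecDeriv φ) a = 0 := by
      rw [hgc, smul_dotProduct, smul_eq_mul] at htr
      exact (mul_eq_zero.1 htr).resolve_left hg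
    set k : K[X] := ∏ b ∈ W.erase b₀, (X - C b) with hk
    have hkdeg : k.natDegree = W.card - 1 := by
      simp [hk, Finset.card_erase_of_mem hb₀]
    have hk0 : k ≠ 0 := (monic_prod_of_monic _ _ fun b _ => monic_X_sub_C b).ne_zero
    have hWpos : 0 < W.card := Finset.card_pos.2 ⟨b₀, hb₀⟩
    obtain ⟨x, hx⟩ := hzspan (k • c) (fun u => by
      rw [Pi.smul_apply, smul_eq_mul]
      have := hcdeg u
      exact natDegree_mul_le.trans (by omega)) (by rw [smul_dotProduct, hcφ, smul_zero])
    apply hdet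
    rw [← Matrix.exists_mulVec_eq_zero_iff]
    refine ⟨x, fun hx0 => ?_, ?_⟩
    · rw [hx0] at hx
      simp only [Pi.zero_apply, zero_smul, Finset.sum_const_zero] at hx
      exact mul_ne_zero hk0 hci (congrFun hx i₀)
    · funext i
      have h1 := hmulVec x i
      rw [← hx, vecEval_eq_mul (p := k • c) (k := k) (c := c) (fun j => rfl), smul_dotProduct] at h1
      refine (mul_eq_zero.1 (h1.trans ?_)).resolve_left (sub_ne_zero.2 (hβa i))
      by_cases hi : β i ∈ W
      · rw [if_pos hi]
        by_cases hib : β i = b₀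
        · rw [hib, hcb, smul_zero]
        · have : k.eval (β i) = 0 := by
            rw [hk, eval_prod]
            exact Finset.prod_eq_zero (Finset.mem_erase.2 ⟨hib, hi⟩) (by simp)
          rw [this, zero_smul]
      · rw [if_neg hi]
        have := congrArg (eval (β i)) hcP
        rw [eval_dotProduct, vecEval_vecC, eval_zero, dotProduct_comm] at this
        rw [this, smul_zero]
  · intro htr hdet
    rw [← Matrix.exists_mulVec_eq_zero_iff] at hdet
    obtain ⟨x, hx0, hx⟩ := hdet
    apply hx0
    apply hzind
    set p := ∑ j, x j • z j with hp
    have hpdeg : ∀ u, (p u).natDegree ≤ N := sum_smul_natDegree_le hzdeg x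
    have hpφ : p ⬝ᵥ φ = 0 := by simp [hp, sum_dotProduct, smul_dotProduct, hzφ]
    have hpi : ∀ i, vecEval p (β i) ⬝ᵥ
        (if β i ∈ W then vecEval (vecDeriv φ) a else vecEval φ a) = 0 := fun i => by
      rw [← hmulVec, hx, Pi.zero_apply, mul_zero]
    have hpa : vecC (vecEval φ a) ⬝ᵥ p = 0 := by
      let γ : Option (Fin N) → K := fun o => o.elim a β
      have hγ : Function.Injective γ := by
        rintro (_ | i) (_ | j) hij
        · rfl
        · exact absurd hij.symm (hβa j)
        · exact absurd hij (hβa i)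
        · exact congrArg some (hβ hij)
      refine eq_zero_of_natDegree_lt_card_of_eval_eq_zero _ hγ (fun o => ?_) ?_
      · rw [eval_dotProduct, vecEval_vecC, dotProduct_comm]
        rcases o with _ | i
        · exact hdot p hpφ a (Finset.mem_insert_self _ _)
        · by_cases hi : β i ∈ W
          · exact hdot p hpφ _ (Finset.mem_insert_of_mem hi)
          · have := hpi i
            rwa [if_neg hi] at this
      · rw [Fintype.card_option, Fintype.card_fin]
        refine Nat.lt_succ_of_le (natDegree_sum_le_of_forall_le _ _ fun u _ => ?_)
        exact (natDegree_C_mul_le _ _).trans (hpdeg u)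
    obtain ⟨k, hk⟩ := exists_eq_mul_of_cross_eq_zero (hpc p hpφ hpa) hc0
    have hkb : ∀ b ∈ W, k.eval b = 0 := fun b hb => by
      obtain ⟨i, rfl⟩ := hβW b hb
      have h1 := hpi i
      rw [if_pos hb, vecEval_eq_mul hk, smul_dotProduct, smul_eq_mul] at h1
      refine (mul_eq_zero.1 h1).resolve_right fun h0 => htr _ hb ?_
      obtain ⟨g, hg, hgc⟩ := hWc _ hb
      rw [hgc, smul_dotProduct, h0, smul_zero]
    have hk0 : k = 0 := by
      by_contra hk0
      have h1 := natDegree_mul hk0 hci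
      rw [← hk] at h1
      have h2 := hpdeg i₀
      exact hk0 (eq_zero_of_natDegree_lt_card_of_eval_eq_zero' k W hkb (by omega))
    exact _root_.funext fun u => by rw [hk u, hk0]; simp

theorem natDegree_det_le_and_coeff_det {N m : ℕ} (A : Matrix (Fin N) (Fin N) K[X])
    (hA : ∀ i j, (A i j).natDegree ≤ m) :
    A.det.natDegree ≤ N * m ∧ A.det.coeff (N * m) = (A.map fun q => q.coeff m).det := by
  constructor
  · rw [Matrix.det_apply]
    refine natDegree_sum_le_of_forall_le _ _ fun σ _ => (natDegree_smul_le _ _).trans ?_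
    refine (natDegree_prod_le _ _).trans ?_
    refine (Finset.sum_le_card_nsmul _ _ m fun i _ => hA _ _).trans ?_
    simp
  · rw [Matrix.det_apply, Matrix.det_apply, finsetSum_coeff]
    refine Finset.sum_congr rfl fun σ _ => ?_
    rw [coeff_smul]
    congr 1
    have := coeff_prod_of_natDegree_le Finset.univ (fun i => A (σ i) i) m fun i _ => hA _ _
    simpa using this

/-- The number of ordered pairs of distinct parameters with the same image, for an immersed chart
of degree `N + 2`, equals `(N + 1) * N` exactly when the branches at such pairs are
transversal. -/
theorem IsImmersedChart.finite_and_ncard_eq_iff [IsAlgClosed K] {N : ℕ} {φ : Fin 3 → K[X]}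
    (h : IsImmersedChart N φ) :
    {q : K × K | q.2 ≠ q.1 ∧ vecEval φ q.1 ⨯₃ vecEval φ q.2 = 0}.Finite ∧
    ({q : K × K | q.2 ≠ q.1 ∧ vecEval φ q.1 ⨯₃ vecEval φ q.2 = 0}.ncard = (N + 1) * N ↔
      ∀ a b, b ≠ a → vecEval φ a ⨯₃ vecEval φ b = 0 →
        (vecEval φ a ⨯₃ vecEval (vecDeriv φ) b) ⬝ᵥ vecEval (vecDeriv φ) a ≠ 0) := by
  classical
  obtain ⟨z, hzdeg, hzφ, hzspan, hzind, hzdet⟩ := h.exists_syzygies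
  choose Φ hΦdeg hΦc hΦ using fun j => exists_quotient N h.natDegree_le (hzdeg j) (hzφ j)
  set A : Matrix (Fin N) (Fin N) K[X] := Matrix.of fun k j => Φ j k with hA
  obtain ⟨hdeg, hcoeff⟩ := natDegree_det_le_and_coeff_det A (m := N + 1) fun i j => hΦdeg j i
  have hc0 : A.det.coeff (N * (N + 1)) ≠ 0 := by
    rw [hcoeff]
    have : (A.map fun q => q.coeff (N + 1)) =
        -(Matrix.of fun k j : Fin N => vecCoeff φ (N + 2) ⬝ᵥ vecCoeff (z j) k) := by
      ext k j
      simp [hA, hΦc]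
    rw [this, Matrix.det_neg]
    exact mul_ne_zero (pow_ne_zero _ (neg_ne_zero.2 one_ne_zero)) hzdet
  have hA0 : A.det ≠ 0 := fun h0 => hc0 (by rw [h0, coeff_zero])
  have hAdeg : A.det.natDegree = N * (N + 1) := le_antisymm hdeg (le_natDegree_of_ne_zero hc0)
  choose W hW hWle hWeq using
    h.rootMultiplicity_det hzdeg hzφ hzspan hzind hA0 (fun j b => hΦ j b)
  set S : Finset K := A.det.roots.toFinset with hS
  have hWS : ∀ a b, b ∈ W a → a ∈ S := fun a b hb => by
    rw [hS, Multiset.mem_toFinset, mem_roots hA0, ← rootMultiplicity_pos hA0]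
    exact (Finset.card_pos.2 ⟨b, hb⟩).trans_le (hWle a)
  have hset : {q : K × K | q.2 ≠ q.1 ∧ vecEval φ q.1 ⨯₃ vecEval φ q.2 = 0} =
      ((S.sigma W).map (Equiv.sigmaEquivProd K K).toEmbedding : Finset (K × K)) := by
    ext ⟨a, b⟩
    simp only [Set.mem_ofPred_eq, Finset.coe_map, Set.mem_image, Finset.mem_coe, Finset.mem_sigma]
    constructor
    · intro hab
      have hb := (hW a b).2 hab
      exact ⟨⟨a, b⟩, ⟨hWS a b hb, hb⟩, rfl⟩
    · rintro ⟨⟨a', b'⟩, ⟨-, hb⟩, heq⟩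
      cases heq
      exact (hW _ _).1 hb
  have hsum : ∑ a ∈ S, A.det.rootMultiplicity a = N * (N + 1) := by
    rw [← hAdeg, ← (IsAlgClosed.splits A.det).natDegree_eq_card_roots.symm,
      ← Multiset.toFinset_sum_count_eq]
    exact Finset.sum_congr rfl fun a _ => (count_roots _).symm
  rw [hset]
  refine ⟨Finset.finite_toSet _, ?_⟩
  rw [Set.ncard_coe_finset, Finset.card_map, Finset.card_sigma, mul_comm (N + 1), ← hsum,
    Finset.sum_eq_sum_iff_of_le fun a _ => hWle a]
  constructor
  · intro hall a b hba hab
    have hb := (hW a b).2 ⟨hba, hab⟩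
    exact (hWeq a).1 (hall a (hWS a b hb)) b hb
  · intro hall a _
    exact (hWeq a).2 fun b hb => hall a b ((hW a b).1 hb).1 ((hW a b).1 hb).2

end Polynomial

section BinaryForms
variable {K : Type*} [Field K]

/-- The restriction of a binary form to the affine line `e₁ + t e₂`. -/
def chartMap (e₁ e₂ : Fin 2 → K) : MvPolynomial (Fin 2) K →ₐ[K] Polynomial K :=
  aeval fun i => Polynomial.C (e₁ i) + Polynomial.C (e₂ i) * Polynomial.X

theorem eval_chartMap (e₁ e₂ : Fin 2 → K) (a : K) (h : MvPolynomial (Fin 2) K) :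
    (chartMap e₁ e₂ h).eval a = eval (e₁ + a • e₂) h := by
  have : (Polynomial.aeval a).comp (chartMap e₁ e₂) = aeval (R := K) (e₁ + a • e₂) := by
    ext i
    simp only [chartMap, AlgHom.comp_apply, aeval_X, map_add, map_mul, Polynomial.aeval_C,
      Polynomial.aeval_X, Algebra.algebraMap_self, RingHom.id_apply, Pi.add_apply, Pi.smul_apply,
      smul_eq_mul, mul_comm]
  have h1 := DFunLike.congr_fun this h
  simpa [Polynomial.coe_aeval_eq_eval, MvPolynomial.aeval_eq_eval] using h1

theorem chartMap_zero_of_isHomogeneous {n : ℕ} {h : MvPolynomial (Fin 2) K}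
    (hh : h.IsHomogeneous n) (v : Fin 2 → K) :
    chartMap 0 v h = Polynomial.C (eval v h) * Polynomial.X ^ n := by
  rw [chartMap, aeval_def, eval₂_eq', eval_eq', map_sum, Finset.sum_mul]
  refine Finset.sum_congr rfl fun d hd => ?_
  have hdeg : d 0 + d 1 = n := by
    have := hh (mem_support_iff.1 hd)
    rw [← this, Finsupp.weight_apply, Finsupp.sum_fintype _ _ (by simp)]
    simp
  simp only [Fin.prod_univ_two, Pi.zero_apply, map_zero, zero_add, Polynomial.algebraMap_eq,
    map_mul, map_pow, ← hdeg]
  ring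

theorem isHomogeneous_linFormOf (v : Fin 2 → K) : (linFormOf v).IsHomogeneous 1 := by
  have key : ∀ (a : K) (i : Fin 2), (C a * X i : MvPolynomial (Fin 2) K).IsHomogeneous 1 :=
    fun a i => (isHomogeneous_C_mul_X a i)
  exact (key _ _).sub (key _ _)

@[simp] theorem eval_linFormOf (v w : Fin 2 → K) :
    eval w (linFormOf v) = v 1 * w 0 - v 0 * w 1 := by
  simp [linFormOf]

theorem linFormOf_smul (k : K) (v : Fin 2 → K) : linFormOf (k • v) = C k * linFormOf v := by
  simp [linFormOf]; ring

theorem linFormOf_dvd_iff {v : Fin 2 → K} (hv : v ≠ 0) (p : MvPolynomial (Fin 2) K) :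
    linFormOf v ∣ p ↔ chartMap 0 v p = 0 := by
  constructor
  · rintro ⟨q, rfl⟩
    rw [map_mul, chartMap_zero_of_isHomogeneous (isHomogeneous_linFormOf v)]
    simp [mul_comm]
  · intro h0
    obtain ⟨k, hk⟩ := Function.ne_iff.1 hv
    rw [← Ideal.mem_span_singleton, ← Ideal.Quotient.eq_zero_iff_mem]
    let π := Ideal.Quotient.mkₐ K (Ideal.span {linFormOf v})
    have hπ : π (linFormOf v) = 0 := by
      simp only [π, Ideal.Quotient.mkₐ_eq_mk, Ideal.Quotient.eq_zero_iff_mem]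
      exact Ideal.mem_span_singleton_self _
    have hcomp : π = (Polynomial.aeval (π (C (v k)⁻¹ * X k))).comp (chartMap 0 v) := by
      refine MvPolynomial.algHom_ext fun i => ?_
      have hmem : X i - C (v i) * (C (v k)⁻¹ * X k) ∈ Ideal.span {linFormOf v} := by
        rw [Ideal.mem_span_singleton]
        have hc : (C (v k)⁻¹ * C (v k) : MvPolynomial (Fin 2) K) = 1 := by
          rw [← C_mul, inv_mul_cancel₀ hk, C_1]
        fin_cases i <;> fin_cases k
        · refine ⟨0, ?_⟩; simp at hc ⊢; linear_combination -(X 0) * hc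
        · refine ⟨C (v 1)⁻¹, ?_⟩; simp [linFormOf] at hc ⊢; linear_combination -(X 0) * hc
        · refine ⟨-C (v 0)⁻¹, ?_⟩; simp [linFormOf] at hc ⊢; linear_combination -(X 1) * hc
        · refine ⟨0, ?_⟩; simp at hc ⊢; linear_combination -(X 1) * hc
      have h1 : π (X i) = π (C (v i) * (C (v k)⁻¹ * X k)) :=
        (Ideal.Quotient.eq.2 hmem)
      rw [h1, AlgHom.comp_apply, chartMap, aeval_X]
      simp only [Pi.zero_apply, map_zero, zero_add, map_mul, Polynomial.aeval_C, Polynomial.aeval_X]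
      rw [← algebraMap_eq, AlgHom.commutes]
    change π p = 0
    rw [hcomp, AlgHom.comp_apply, h0, map_zero]

theorem linFormOf_ne_zero {v : Fin 2 → K} (hv : v ≠ 0) : linFormOf v ≠ 0 := by
  intro h0
  apply hv
  have h1 := congrArg (eval ![1, 0]) h0
  have h2 := congrArg (eval ![0, 1]) h0
  simp at h1 h2
  funext i
  fin_cases i <;> simp [h1, h2]

theorem prime_linFormOf {v : Fin 2 → K} (hv : v ≠ 0) : Prime (linFormOf v) := by
  refine ⟨linFormOf_ne_zero hv, fun hu => ?_, fun a b hab => ?_⟩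
  · have := hu.map (eval v)
    simp [mul_comm] at this
  · simp only [linFormOf_dvd_iff hv, map_mul] at hab ⊢
    exact mul_eq_zero.1 hab

theorem linFormOf_dvd_iff_eval {n : ℕ} {h : MvPolynomial (Fin 2) K} (hh : h.IsHomogeneous n)
    {v : Fin 2 → K} (hv : v ≠ 0) : linFormOf v ∣ h ↔ eval v h = 0 := by
  rw [linFormOf_dvd_iff hv, chartMap_zero_of_isHomogeneous hh]
  simp

theorem exists_isHomogeneous_of_mul {m n : ℕ} {h l g : MvPolynomial (Fin 2) K}
    (hh : h.IsHomogeneous n) (hl : l.IsHomogeneous m) (hmn : m ≤ n) (hg : h = l * g) :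
    ∃ g', g'.IsHomogeneous (n - m) ∧ h = l * g' := by
  refine ⟨homogeneousComponent (n - m) g, homogeneousComponent_isHomogeneous _ _, ?_⟩
  let _ : GradedAlgebra (homogeneousSubmodule (Fin 2) K) := gradedAlgebra
  have h1 := DirectSum.coe_decompose_mul_of_left_mem_of_le
    (homogeneousSubmodule (Fin 2) K) (a := l) (b := g) (i := m) hl hmn
  rw [← hg, DirectSum.decompose_of_mem_same _ hh] at h1
  rw [h1, ← decomposition.decompose'_apply]
  rfl

theorem exists_eq_C_of_isHomogeneous_zero {σ R : Type*} [CommSemiring R] {h : MvPolynomial σ R}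
    (hh : h.IsHomogeneous 0) : ∃ c, h = C c :=
  ⟨_, totalDegree_eq_zero_iff_eq_C.1 ((totalDegree_zero_iff_isHomogeneous σ).2 hh)⟩

theorem exists_eq_linFormOf_mul {n : ℕ} {h : MvPolynomial (Fin 2) K} (hh : h.IsHomogeneous n)
    {v : Fin 2 → K} (hv : v ≠ 0) (h0 : eval v h = 0) :
    ∃ g, g.IsHomogeneous (n - 1) ∧ h = linFormOf v * g := by
  obtain ⟨g, hg⟩ := (linFormOf_dvd_iff_eval hh hv).2 h0
  rcases Nat.eq_zero_or_pos n with rfl | hn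
  · refine ⟨0, isHomogeneous_zero _ _ _, ?_⟩
    rw [mul_zero]
    obtain ⟨c, rfl⟩ := exists_eq_C_of_isHomogeneous_zero hh
    simp only [eval_C] at h0
    rw [h0, C_0]
  · exact exists_isHomogeneous_of_mul hh (isHomogeneous_linFormOf v) hn hg

theorem chartMap_natDegree_le_and_coeff {n : ℕ} {h : MvPolynomial (Fin 2) K}
    (hh : h.IsHomogeneous n) (e₁ e₂ : Fin 2 → K) :
    (chartMap e₁ e₂ h).natDegree ≤ n ∧ (chartMap e₁ e₂ h).coeff n = eval e₂ h := by
  have hlin : ∀ i, (Polynomial.C (e₁ i) + Polynomial.C (e₂ i) * Polynomial.X).natDegree ≤ 1 :=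
    fun i => by rw [add_comm]; exact Polynomial.natDegree_linear_le
  have hpow : ∀ i m, ((Polynomial.C (e₁ i) + Polynomial.C (e₂ i) * Polynomial.X) ^ m).natDegree ≤ m :=
    fun i m => (Polynomial.natDegree_pow_le_of_le m (hlin i)).trans (by simp)
  have hcoef : ∀ i m, ((Polynomial.C (e₁ i) + Polynomial.C (e₂ i) * Polynomial.X) ^ m).coeff m =
      e₂ i ^ m := fun i m => by
    have := Polynomial.coeff_pow_of_natDegree_le (n := 1) (m := m) (hlin i)
    simpa using this
  have hdeg : ∀ d ∈ h.support, d 0 + d 1 = n := fun d hd => by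
    have := hh (mem_support_iff.1 hd)
    rw [← this, Finsupp.weight_apply, Finsupp.sum_fintype _ _ (by simp)]
    simp
  rw [chartMap, aeval_def, eval₂_eq', eval_eq']
  simp only [Fin.prod_univ_two, Polynomial.algebraMap_eq]
  constructor
  · refine Polynomial.natDegree_sum_le_of_forall_le _ _ fun d hd => ?_
    refine (Polynomial.natDegree_C_mul_le _ _).trans (Polynomial.natDegree_mul_le.trans ?_)
    rw [← hdeg d hd]
    exact add_le_add (hpow _ _) (hpow _ _)
  · rw [Polynomial.finsetSum_coeff]
    refine Finset.sum_congr rfl fun d hd => ?_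
    rw [Polynomial.coeff_C_mul, ← hdeg d hd,
      Polynomial.coeff_mul_add_eq_of_natDegree_le (hpow _ _) (hpow _ _), hcoef, hcoef]

theorem chartMap_linFormOf (e₁ e₂ : Fin 2 → K) (a : K) :
    chartMap e₁ e₂ (linFormOf (e₁ + a • e₂)) =
      Polynomial.C (e₁ 1 * e₂ 0 - e₁ 0 * e₂ 1) * (Polynomial.X - Polynomial.C a) := by
  simp only [linFormOf, chartMap, map_sub, map_mul, aeval_X, aeval_C, Polynomial.algebraMap_eq,
    Pi.add_apply, Pi.smul_apply, smul_eq_mul, map_add]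
  ring

theorem chartMap_linFormOf_infty (e₁ e₂ : Fin 2 → K) :
    chartMap e₁ e₂ (linFormOf e₂) = Polynomial.C (-(e₁ 1 * e₂ 0 - e₁ 0 * e₂ 1)) := by
  simp only [linFormOf, chartMap, map_sub, map_mul, aeval_X, aeval_C, Polynomial.algebraMap_eq,
    map_neg]
  ring

variable {e₁ e₂ : Fin 2 → K}

theorem add_smul_ne_zero_of_det_ne_zero (hδ : e₁ 1 * e₂ 0 - e₁ 0 * e₂ 1 ≠ 0) (a : K) :
    e₁ + a • e₂ ≠ 0 := by
  intro h0
  apply hδ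
  have h1 := congrFun h0 0
  have h2 := congrFun h0 1
  simp at h1 h2
  linear_combination e₂ 0 * h2 - e₂ 1 * h1

theorem ne_zero_of_det_ne_zero (hδ : e₁ 1 * e₂ 0 - e₁ 0 * e₂ 1 ≠ 0) : e₂ ≠ 0 := by
  rintro rfl; simp at hδ

theorem chartMap_eq_zero {n : ℕ} {h : MvPolynomial (Fin 2) K} (hh : h.IsHomogeneous n)
    (hδ : e₁ 1 * e₂ 0 - e₁ 0 * e₂ 1 ≠ 0) (h0 : chartMap e₁ e₂ h = 0) : h = 0 := by
  induction n generalizing h with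
  | zero =>
    obtain ⟨c, rfl⟩ := exists_eq_C_of_isHomogeneous_zero hh
    rw [chartMap, aeval_C, Polynomial.algebraMap_eq, Polynomial.C_eq_zero] at h0
    rw [h0, C_0]
  | succ n ih =>
    have he : e₁ + (0 : K) • e₂ ≠ 0 := add_smul_ne_zero_of_det_ne_zero hδ 0
    obtain ⟨g, hg, rfl⟩ := exists_eq_linFormOf_mul hh he
      (by rw [← eval_chartMap, h0, Polynomial.eval_zero])
    rw [map_mul, chartMap_linFormOf] at h0
    rw [ih hg, mul_zero]
    refine (mul_eq_zero.1 h0).resolve_left (mul_ne_zero (Polynomial.C_ne_zero.2 hδ)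
      (Polynomial.X_sub_C_ne_zero _))

theorem linFormOf_sq_dvd_iff {n : ℕ} {h : MvPolynomial (Fin 2) K} (hh : h.IsHomogeneous n)
    (hδ : e₁ 1 * e₂ 0 - e₁ 0 * e₂ 1 ≠ 0) (a : K) :
    linFormOf (e₁ + a • e₂) ^ 2 ∣ h ↔
      (chartMap e₁ e₂ h).eval a = 0 ∧ (Polynomial.derivative (chartMap e₁ e₂ h)).eval a = 0 := by
  have he : e₁ + a • e₂ ≠ 0 := add_smul_ne_zero_of_det_ne_zero hδ a
  constructor
  · rintro ⟨g, rfl⟩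
    rw [map_mul, map_pow, chartMap_linFormOf]
    simp [-map_mul, -map_sub, -map_add, Polynomial.derivative_pow]
  · rintro ⟨h0, h1⟩
    rw [eval_chartMap] at h0
    obtain ⟨g, hg, rfl⟩ := exists_eq_linFormOf_mul hh he h0
    rw [map_mul, chartMap_linFormOf] at h1
    simp only [Polynomial.derivative_mul, Polynomial.derivative_C, zero_mul, zero_add,
      Polynomial.derivative_sub, Polynomial.derivative_X, sub_zero, mul_one, Polynomial.eval_add,
      Polynomial.eval_mul, Polynomial.eval_C, Polynomial.eval_sub, Polynomial.eval_X, sub_self,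
      mul_zero, add_zero] at h1
    have h2 := (mul_eq_zero.1 h1).resolve_left hδ
    rw [eval_chartMap] at h2
    obtain ⟨k, -, rfl⟩ := exists_eq_linFormOf_mul hg he h2
    exact ⟨k, by ring⟩

theorem linFormOf_infty_sq_dvd {n : ℕ} {h : MvPolynomial (Fin 2) K} (hh : h.IsHomogeneous n)
    (hδ : e₁ 1 * e₂ 0 - e₁ 0 * e₂ 1 ≠ 0) (h0 : (chartMap e₁ e₂ h).coeff n = 0)
    (h1 : (chartMap e₁ e₂ h).coeff (n - 1) = 0) : linFormOf e₂ ^ 2 ∣ h := by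
  have he := ne_zero_of_det_ne_zero hδ
  rw [(chartMap_natDegree_le_and_coeff hh e₁ e₂).2] at h0
  obtain ⟨g, hg, rfl⟩ := exists_eq_linFormOf_mul hh he h0
  rw [map_mul, chartMap_linFormOf_infty, Polynomial.coeff_C_mul,
    (chartMap_natDegree_le_and_coeff hg e₁ e₂).2] at h1
  obtain ⟨k, -, rfl⟩ := exists_eq_linFormOf_mul hg he
    ((mul_eq_zero.1 h1).resolve_left (neg_ne_zero.2 hδ))
  exact ⟨k, by ring⟩

theorem linFormOf_mul_dvd_iff {n : ℕ} {h : MvPolynomial (Fin 2) K} (hh : h.IsHomogeneous n)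
    {v w : Fin 2 → K} (hvw : v 1 * w 0 - v 0 * w 1 ≠ 0) :
    linFormOf v * linFormOf w ∣ h ↔ eval v h = 0 ∧ eval w h = 0 := by
  have hw : w ≠ 0 := by rintro rfl; simp at hvw
  have hv : v ≠ 0 := by rintro rfl; simp at hvw
  constructor
  · rintro ⟨g, rfl⟩
    simp [mul_comm]
  · rintro ⟨h1, h2⟩
    obtain ⟨g, hg, rfl⟩ := exists_eq_linFormOf_mul hh hv h1
    rw [map_mul, eval_linFormOf] at h2
    obtain ⟨k, -, rfl⟩ := exists_eq_linFormOf_mul hg hw ((mul_eq_zero.1 h2).resolve_left hvw)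
    exact ⟨k, by ring⟩

theorem exists_smul_of_det_eq_zero {v w : Fin 2 → K} (hv : v ≠ 0) (h : v 1 * w 0 - v 0 * w 1 = 0) :
    ∃ d : K, w = d • v := by
  obtain ⟨k, hk⟩ := Function.ne_iff.1 hv
  refine ⟨w k / v k, ?_⟩
  simp only [Pi.zero_apply] at hk
  funext i
  rw [Pi.smul_apply, smul_eq_mul, div_mul_eq_mul_div, eq_div_iff hk]
  fin_cases i <;> fin_cases k <;> simp <;>
    first | linear_combination h | linear_combination -h

theorem exists_eval_eq_zero [IsAlgClosed K] {n : ℕ} {h : MvPolynomial (Fin 2) K}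
    (hh : h.IsHomogeneous n) (hn : 1 ≤ n) : ∃ v : Fin 2 → K, v ≠ 0 ∧ eval v h = 0 := by
  by_cases h0 : eval ![1, 0] h = 0
  · exact ⟨_, by simp, h0⟩
  · obtain ⟨h1, h2⟩ := chartMap_natDegree_le_and_coeff hh ![0, 1] ![1, 0]
    rw [← h2] at h0
    have h3 := Polynomial.le_natDegree_of_ne_zero h0
    obtain ⟨a, ha⟩ := IsAlgClosed.exists_root (chartMap ![0, 1] ![1, 0] h) fun hd => by
      rw [Polynomial.natDegree_eq_zero_iff_degree_le_zero.2 hd.le] at h3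
      omega
    rw [Polynomial.IsRoot, eval_chartMap] at ha
    exact ⟨_, add_smul_ne_zero_of_det_ne_zero (by simp) a, ha⟩

theorem exists_linFormOf_dvd_of_dvd [IsAlgClosed K] {n : ℕ} {h g : MvPolynomial (Fin 2) K}
    (hh : h.IsHomogeneous n) (h0 : h ≠ 0) (hg : ¬ IsUnit g) (hgh : g ∣ h) :
    ∃ v : Fin 2 → K, v ≠ 0 ∧ linFormOf v ∣ g := by
  induction n generalizing h with
  | zero =>
    obtain ⟨c, rfl⟩ := exists_eq_C_of_isHomogeneous_zero hh
    have hc : c ≠ 0 := by rintro rfl; simp at h0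
    exact absurd (isUnit_of_dvd_unit hgh ((isUnit_iff_ne_zero.2 hc).map C)) hg
  | succ n ih =>
    obtain ⟨v, hv, hv0⟩ := exists_eval_eq_zero hh (by omega)
    obtain ⟨k, hk, rfl⟩ := exists_eq_linFormOf_mul hh hv hv0
    by_cases hd : linFormOf v ∣ g
    · exact ⟨v, hv, hd⟩
    · obtain ⟨m, hm⟩ := hgh
      rcases (prime_linFormOf hv).dvd_or_dvd (Dvd.intro _ hm) with h1 | ⟨m', rfl⟩
      · exact ⟨v, hv, h1⟩
      · refine ih hk (right_ne_zero_of_mul h0) ⟨m', ?_⟩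
        refine mul_left_cancel₀ (linFormOf_ne_zero hv) ?_
        rw [hm]; ring

/-- The coefficient vector of the product of the linear forms with roots `v` and `w`. -/
def pairVec (v w : Fin 2 → K) : Fin 3 → K :=
  ![v 1 * w 1, -(v 1 * w 0 + v 0 * w 1), v 0 * w 0]

theorem formOf_pairVec (v w : Fin 2 → K) : formOf 2 (pairVec v w) = linFormOf v * linFormOf w := by
  simp [formOf, Fin.sum_univ_three, pairVec, linFormOf]
  ring

theorem onConic_pairVec_iff (v w : Fin 2 → K) :
    onConic (pairVec v w) ↔ v 1 * w 0 - v 0 * w 1 = 0 := by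
  rw [← sq_eq_zero_iff, onConic, ← neg_eq_zero]
  simp only [pairVec, Matrix.cons_val]
  ring_nf

theorem onConic_smul_iff {k : K} (hk : k ≠ 0) (x : Fin 3 → K) : onConic (k • x) ↔ onConic x := by
  have : 4 * (k • x) 0 * (k • x) 2 - (k • x) 1 ^ 2 = k ^ 2 * (4 * x 0 * x 2 - x 1 ^ 2) := by
    simp only [Pi.smul_apply, smul_eq_mul]; ring
  rw [onConic, this, onConic]
  simp [hk]

theorem exists_eq_pairVec [IsAlgClosed K] {x : Fin 3 → K} (hx : x ≠ 0) :
    ∃ v w : Fin 2 → K, v ≠ 0 ∧ w ≠ 0 ∧ x = pairVec v w := by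
  suffices h : ∃ v w : Fin 2 → K, x = pairVec v w by
    obtain ⟨v, w, rfl⟩ := h
    refine ⟨v, w, ?_, ?_, rfl⟩ <;> rintro rfl <;> apply hx <;> funext i <;> fin_cases i <;>
      simp [pairVec]
  by_cases h0 : x 0 = 0
  · refine ⟨![-1, 0], ![-x 2, x 1], ?_⟩
    funext i; fin_cases i <;> simp [pairVec, h0]
  · obtain ⟨r, hr⟩ := IsAlgClosed.exists_root
      (Polynomial.C (x 0) * Polynomial.X ^ 2 + Polynomial.C (x 1) * Polynomial.X + Polynomial.C (x 2))
      (by rw [Polynomial.degree_quadratic h0]; decide)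
    simp only [Polynomial.IsRoot, Polynomial.eval_add, Polynomial.eval_mul, Polynomial.eval_C,
      Polynomial.eval_pow, Polynomial.eval_X] at hr
    refine ⟨![r, 1], ![-(x 1 + x 0 * r), x 0], ?_⟩
    funext i; fin_cases i <;> simp [pairVec] 
    · ring
    · linear_combination hr

end BinaryForms

section Minors
open scoped Matrix
variable {K : Type*} [Field K]

theorem rank_lt_iff_forall_minors_eq_zero {m : ℕ} (E : Matrix (Fin (m + 1)) (Fin m) K) :
    E.rank < m ↔ ∀ (r : Fin m → Fin (m + 1)) (c : Fin m → Fin m), Function.Injective r →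
      Function.Injective c → (E.submatrix r c).det = 0 := by
  constructor
  · intro hr r c _ _
    by_contra hdet
    have h1 : (E.submatrix r c).rank = m := by
      rw [Matrix.rank_of_isUnit _ ((Matrix.isUnit_iff_isUnit_det _).2 (isUnit_iff_ne_zero.2 hdet))]
      simp
    have h2 : (E.submatrix r c).rank ≤ E.rank := Matrix.rank_submatrix_le E r c
    omega
  · intro h
    by_contra hlt
    have hrank : E.rank = m := le_antisymm (by simpa using E.rank_le_width) (by omega)
    obtain ⟨κ, a, ha, hspan, hli⟩ := exists_linearIndependent' K E.row
    have : Finite κ := Finite.of_injective a ha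
    have : Fintype κ := Fintype.ofFinite κ
    have hcard : Fintype.card κ = m := by
      rw [← hrank, Matrix.rank_eq_finrank_span_row, ← hspan, finrank_span_eq_card hli]
    let e : Fin m ≃ κ := (Fintype.equivFinOfCardEq hcard).symm
    have h0 := h (a ∘ e) id (ha.comp e.injective) Function.injective_id
    have hli' : LinearIndependent K (E.submatrix (a ∘ e) id).row := hli.comp e e.injective
    rw [Matrix.linearIndependent_rows_iff_isUnit, Matrix.isUnit_iff_isUnit_det, h0] at hli'
    exact not_isUnit_zero hli'

theorem finrank_ker_vecMulLinear {m : ℕ} (E : Matrix (Fin (m + 1)) (Fin m) K) :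
    Module.finrank K (LinearMap.ker E.vecMulLinear) + E.rank = m + 1 := by
  have h1 := LinearMap.finrank_range_add_finrank_ker E.vecMulLinear
  have h2 : Module.finrank K (LinearMap.range E.vecMulLinear) = E.rank := by
    rw [← Matrix.rank_transpose, Matrix.rank, Matrix.mulVecLin_transpose]
  rw [h2] at h1
  simp at h1
  omega

theorem chartMap_formOf (k : ℕ) (x : Fin (k + 1) → K) :
    chartMap ![1, 0] ![0, 1] (formOf k x) = ∑ i, Polynomial.C (x i) * Polynomial.X ^ (i : ℕ) := by
  simp [formOf, chartMap]

theorem formOf_eq_zero {k : ℕ} {x : Fin (k + 1) → K} (h : formOf k x = 0) : x = 0 := by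
  funext i
  have h1 := congrArg (fun p => (chartMap ![1, 0] ![0, 1] p).coeff (i : ℕ)) h
  simp only [chartMap_formOf, map_zero, Polynomial.coeff_zero] at h1
  simpa [Polynomial.finsetSum_coeff, Polynomial.coeff_X_pow, Fin.val_inj] using h1

theorem formOf_eq_sum_monomial (k : ℕ) (x : Fin (k + 1) → K) : formOf k x =
    ∑ i : Fin (k + 1), monomial (Finsupp.single 0 (k - (i : ℕ)) + Finsupp.single 1 (i : ℕ)) (x i) := by
  refine Finset.sum_congr rfl fun i _ => ?_
  rw [X_pow_eq_monomial, X_pow_eq_monomial, C_apply, monomial_mul, monomial_mul]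
  simp

theorem formOf_bcoeff {k : ℕ} {h : MvPolynomial (Fin 2) K} (hh : h.IsHomogeneous k) :
    formOf k (bcoeff k h) = h := by
  ext d
  rw [formOf_eq_sum_monomial, coeff_sum]
  simp only [coeff_monomial]
  by_cases hd : d 0 + d 1 = k
  · have hlt : d 1 < k + 1 := by omega
    rw [Finset.sum_eq_single ⟨d 1, hlt⟩]
    · have : Finsupp.single 0 (k - d 1) + Finsupp.single 1 (d 1) = d := by
        ext i; fin_cases i <;> simp [← hd]
      simp only [bcoeff, this, if_true]
    · intro i _ hi
      rw [if_neg]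
      intro heq
      apply hi
      have := DFunLike.congr_fun heq 1
      simp at this
      exact Fin.ext this
    · simp
  · rw [Finset.sum_eq_zero]
    · symm
      refine hh.coeff_eq_zero fun h0 => hd ?_
      rw [← h0, Finsupp.degree_eq_sum, Fin.sum_univ_two]
    · intro i _
      rw [if_neg]
      rintro rfl
      apply hd
      simp
      omega

theorem formOf_sum_smul {k m : ℕ} (y : Fin m → K) (r : Fin m → Fin (k + 1) → K) :
    formOf k (∑ j, y j • r j) = ∑ j, C (y j) * formOf k (r j) := by
  simp only [formOf, Finset.sum_apply, Pi.smul_apply, smul_eq_mul, map_sum, map_mul,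
    Finset.sum_mul, Finset.mul_sum]
  rw [Finset.sum_comm]
  exact Finset.sum_congr rfl fun _ _ => Finset.sum_congr rfl fun _ _ => by ring

variable (N : ℕ) (f : Fin 3 → MvPolynomial (Fin 2) K) (x : Fin 3 → K)

/-- The value of the matrix `M_2` at `x`. -/
def evalMmat : Matrix (Fin (N + 1 + 3)) (Fin (N + 2 + 1)) K :=
  (Mmat (N + 2) 2 f).map (eval x)

theorem formOf_evalMmat_castAdd (j : Fin (N + 1)) :
    formOf (N + 2) (evalMmat N f x (Fin.castAdd 3 j)) =
      X 0 ^ (N - (j : ℕ)) * X 1 ^ (j : ℕ) * formOf 2 x := by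
  have hj : (j : ℕ) ≤ N := Nat.lt_succ_iff.1 j.2
  have hent : ∀ c, evalMmat N f x (Fin.castAdd 3 j) c =
      if h : (j : ℕ) ≤ (c : ℕ) ∧ (c : ℕ) ≤ (j : ℕ) + 2 then x ⟨(c : ℕ) - (j : ℕ), by omega⟩
      else 0 := fun c => by
    have : evalMmat N f x (Fin.castAdd 3 j) c =
      eval x (if h : (j : ℕ) ≤ (c : ℕ) ∧ (c : ℕ) ≤ (j : ℕ) + 2 then
        X ⟨(c : ℕ) - (j : ℕ), by omega⟩ else 0) := congrArg (eval x) (dif_pos hj)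
    rw [this]
    split_ifs <;> simp
  rw [formOf, formOf, Finset.mul_sum]
  symm
  refine Finset.sum_of_injOn (fun i : Fin 3 => (⟨j + i, by omega⟩ : Fin (N + 2 + 1))) ?_ ?_ ?_ ?_
  · intro i _ i' _ h
    simpa [Fin.ext_iff] using h
  · intro i _; simp
  · intro c _ hc
    rw [hent, dif_neg, map_zero, zero_mul, zero_mul]
    rintro ⟨h1, h2⟩
    exact hc ⟨⟨c - j, by omega⟩, by simp, Fin.ext (by simp; omega)⟩
  · intro i _
    have hi : (i : ℕ) ≤ 2 := by omega
    rw [hent, dif_pos ⟨by simp, by simp; omega⟩]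
    simp only [add_tsub_cancel_left, Fin.eta]
    rw [show N + 2 - (j + i : ℕ) = (N - j) + (2 - i) by omega]
    ring

theorem formOf_evalMmat_natAdd (hf : ∀ u, (f u).IsHomogeneous (N + 2)) (u : Fin 3) :
    formOf (N + 2) (evalMmat N f x (Fin.natAdd (N + 1) u)) = f u := by
  rw [← formOf_bcoeff (hf u)]
  congr 1
  funext c
  have hj : ¬ ((Fin.natAdd (N + 1) u : Fin (N + 1 + 3)) : ℕ) ≤ N := by simp; omega
  have : evalMmat N f x (Fin.natAdd (N + 1) u) c =
    eval x (C (bcoeff (N + 2) (f ⟨(Fin.natAdd (N + 1) u : Fin (N + 1 + 3)) - (N + 1), by simp⟩) c)) :=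
      congrArg (eval x) (dif_neg hj)
  rw [this, eval_C]
  simp

theorem formOf_vecMul_evalMmat (hf : ∀ u, (f u).IsHomogeneous (N + 2)) (y : Fin (N + 1 + 3) → K) :
    formOf (N + 2) (y ᵥ* evalMmat N f x) =
      formOf N (fun j => y (Fin.castAdd 3 j)) * formOf 2 x +
        ∑ u, C (y (Fin.natAdd (N + 1) u)) * f u := by
  have h := formOf_sum_smul (k := N + 2) y fun j => evalMmat N f x j
  rw [Matrix.vecMul_eq_sum]
  refine h.trans ?_
  rw [Fin.sum_univ_add]
  congr 1
  · simp only [formOf_evalMmat_castAdd]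
    rw [show formOf N (fun j => y (Fin.castAdd 3 j)) = ∑ j : Fin (N + 1),
      C (y (Fin.castAdd 3 j)) * X 0 ^ (N - (j : ℕ)) * X 1 ^ (j : ℕ) from rfl, Finset.sum_mul]
    exact Finset.sum_congr rfl fun j _ => by ring
  · simp only [formOf_evalMmat_natAdd N f x hf]

theorem forall_minors_eq_zero_iff :
    (∀ g ∈ minorsSet (N + 2) 2 f, eval x g = 0) ↔ (evalMmat N f x).rank < N + 2 + 1 := by
  rw [rank_lt_iff_forall_minors_eq_zero]
  constructor
  · intro h r c hr hc
    have := h _ ⟨r, c, hr, hc, rfl⟩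
    rw [RingHom.map_det] at this
    exact this
  · rintro h g ⟨r, c, hr, hc, rfl⟩
    rw [RingHom.map_det]
    exact h r c hr hc

variable {N f}

theorem forall_minors_eq_zero_iff_dvd (hf : ∀ u, (f u).IsHomogeneous (N + 2)) {v w : Fin 2 → K}
    (hv : v ≠ 0) (hw : w ≠ 0) (hfv : evalVec f v ≠ 0) :
    (∀ g ∈ minorsSet (N + 2) 2 f, eval (pairVec v w) g = 0) ↔
      ∀ c : Fin 3 → K, c ⬝ᵥ evalVec f v = 0 →
        linFormOf v * linFormOf w ∣ ∑ u, C (c u) * f u := by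
  set E := evalMmat N f (pairVec v w) with hE
  have hq0 : linFormOf v * linFormOf w ≠ 0 := mul_ne_zero (linFormOf_ne_zero hv) (linFormOf_ne_zero hw)
  have hker : ∀ y, y ᵥ* E = 0 ↔ formOf N (fun j => y (Fin.castAdd 3 j)) *
      (linFormOf v * linFormOf w) + ∑ u, C (y (Fin.natAdd (N + 1) u)) * f u = 0 := fun y => by
    rw [← formOf_pairVec, ← formOf_vecMul_evalMmat _ _ _ hf]
    constructor
    · intro h; rw [h]; simp [formOf]
    · exact formOf_eq_zero
  let ev : (Fin 3 → K) →ₗ[K] K := (dotProductBilin K K).flip (evalVec f v)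
  have hev : ∀ c, ev c = c ⬝ᵥ evalVec f v := fun c => rfl
  have hev0 : ev ≠ 0 := fun h0 => hfv (dotProduct_eq_zero _ fun c => by
    rw [dotProduct_comm, ← hev, h0, LinearMap.zero_apply])
  have hevker : Module.finrank K (LinearMap.ker ev) = 2 := by
    have := Module.Dual.finrank_ker_add_one_of_ne_zero hev0
    simp at this
    exact this
  let pr : (Fin (N + 1 + 3) → K) →ₗ[K] (Fin 3 → K) := LinearMap.funLeft K K (Fin.natAdd (N + 1))
  have hpr : ∀ y u, pr y u = y (Fin.natAdd (N + 1) u) := fun y u => rfl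
  have hmaps : ∀ y ∈ LinearMap.ker E.vecMulLinear, pr y ∈ LinearMap.ker ev := fun y hy => by
    have h1 := congrArg (eval v) ((hker y).1 hy)
    simp only [map_add, map_mul, eval_linFormOf, map_sum, eval_C, map_zero] at h1
    rw [LinearMap.mem_ker, hev, ← h1]
    simp [dotProduct, evalVec, hpr, mul_comm]
  let L := pr.restrict hmaps
  have hLinj : Function.Injective L := by
    refine (injective_iff_map_eq_zero _).2 fun y hy => Subtype.ext ?_
    have h0 : ∀ u, (y : Fin (N + 1 + 3) → K) (Fin.natAdd (N + 1) u) = 0 := fun u =>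
      congrFun (congrArg Subtype.val hy) u
    have h1 := (hker y).1 y.2
    simp only [h0, map_zero, zero_mul, Finset.sum_const_zero, add_zero] at h1
    have h2 := formOf_eq_zero ((mul_eq_zero.1 h1).resolve_right hq0)
    funext i
    refine Fin.addCases (fun j => ?_) (fun u => ?_) i
    · exact congrFun h2 j
    · exact h0 u
  have hle := LinearMap.finrank_le_finrank_of_injective hLinj
  have hrank : Module.finrank K (LinearMap.ker E.vecMulLinear) + E.rank = N + 2 + 1 + 1 :=
    finrank_ker_vecMulLinear E
  rw [hevker] at hle
  rw [forall_minors_eq_zero_iff, ← hE]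
  constructor
  · intro hlt c hc
    have heq : Module.finrank K (LinearMap.ker E.vecMulLinear) =
      Module.finrank K (LinearMap.ker ev) := by
        rw [hevker]; omega
    obtain ⟨y, hy⟩ := (LinearMap.injective_iff_surjective_of_finrank_eq_finrank heq).1 hLinj ⟨c, hc⟩
    have h0 : ∀ u, (y : Fin (N + 1 + 3) → K) (Fin.natAdd (N + 1) u) = c u := fun u =>
      congrFun (congrArg Subtype.val hy) u
    have h1 := (hker y).1 y.2
    simp only [h0] at h1
    exact ⟨-formOf N fun j => (y : Fin (N + 1 + 3) → K) (Fin.castAdd 3 j), by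
      linear_combination h1⟩
  · intro h
    have hsurj : Function.Surjective L := by
      rintro ⟨c, hc⟩
      obtain ⟨g, hg⟩ := h c hc
      obtain ⟨g', hg', hgg⟩ := exists_isHomogeneous_of_mul (m := 2) (n := N + 2)
        (IsHomogeneous.sum _ _ _ fun u _ => (hf u).C_mul (c u))
        ((isHomogeneous_linFormOf v).mul (isHomogeneous_linFormOf w)) (by omega) hg
      have hg2 : formOf N (bcoeff N g') = g' := formOf_bcoeff hg'
      refine ⟨⟨Fin.append (fun j => -bcoeff N g' j) c, ?_⟩, Subtype.ext ?_⟩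
      · refine (hker _).2 ?_
        have hneg : formOf N (fun j => -bcoeff N g' j) = -g' := by
          conv_rhs => rw [← hg2]
          simp [formOf]
        simp only [Fin.append_left, Fin.append_right]
        rw [hneg, hgg]; ring
      · funext u
        show Fin.append (fun j => -bcoeff N g' j) c (Fin.natAdd (N + 1) u) = c u
        exact Fin.append_right _ _ u
    have h2 := (LinearEquiv.ofBijective L ⟨hLinj, hsurj⟩).finrank_eq
    rw [hevker] at h2
    omega

end Minors

theorem Polynomial.eq_zero_of_eval₂_eq_zero_of_natDegree_lt {R S : Type*} [CommRing R] [IsDomain R]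
    [UniqueFactorizationMonoid R] [CommRing S] [IsDomain S] {φ : R →+* S}
    (hφ : Function.Injective φ) {y : S} {p g : Polynomial R} (hp : Irreducible p)
    (hpy : p.eval₂ φ y = 0) (hgy : g.eval₂ φ y = 0) (hlt : g.natDegree < p.natDegree) : g = 0 := by
  by_contra hg
  let _ : NormalizedGCDMonoid R := Classical.choice inferInstance
  have hinj := IsFractionRing.injective R (FractionRing R)
  have hirr : Irreducible (p.map (algebraMap R (FractionRing R))) :=
    ((hp.isPrimitive (by omega)).irreducible_iff_irreducible_map_fraction_map).1 hp
  have hcop : IsCoprime (p.map (algebraMap R (FractionRing R)))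
      (g.map (algebraMap R (FractionRing R))) := by
    refine (hirr.coprime_iff_not_dvd).2 fun hdvd => ?_
    have h1 := Polynomial.natDegree_le_of_dvd hdvd ((Polynomial.map_ne_zero_iff hinj).2 hg)
    rw [Polynomial.natDegree_map_eq_of_injective hinj,
      Polynomial.natDegree_map_eq_of_injective hinj] at h1
    omega
  obtain ⟨a, b, hab⟩ := hcop
  have h2 := congrArg (Polynomial.eval₂ (IsFractionRing.map (K := FractionRing R)
    (L := FractionRing S) hφ) (algebraMap S (FractionRing S) y)) hab
  have hcomp : (IsFractionRing.map (K := FractionRing R) (L := FractionRing S) hφ).comp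
      (algebraMap R (FractionRing R)) = (algebraMap S (FractionRing S)).comp φ := by
    ext r; simp [IsFractionRing.map]
  rw [Polynomial.eval₂_add, Polynomial.eval₂_mul, Polynomial.eval₂_mul, Polynomial.eval₂_map,
    Polynomial.eval₂_map, hcomp, ← Polynomial.hom_eval₂, ← Polynomial.hom_eval₂, hpy, hgy] at h2
  simp at h2

section Independence
variable {K : Type*} [Field K]

theorem exists_matrix_col_eq {p : Fin 3 → K} (hp : p ≠ 0) :
    ∃ A B : Matrix (Fin 3) (Fin 3) K, A * B = 1 ∧ B * A = 1 ∧ ∀ i, A i 0 = p i := by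
  suffices h : ∃ A : Matrix (Fin 3) (Fin 3) K, A.det ≠ 0 ∧ ∀ i, A i 0 = p i by
    obtain ⟨A, hA, h0⟩ := h
    exact ⟨A, A⁻¹, A.mul_nonsing_inv hA.isUnit, A.nonsing_inv_mul hA.isUnit, h0⟩
  obtain ⟨k, hk⟩ := Function.ne_iff.1 hp
  fin_cases k
  · refine ⟨!![p 0, 0, 0; p 1, 1, 0; p 2, 0, 1], by simpa [Matrix.det_fin_three] using hk, ?_⟩
    intro i; fin_cases i <;> rfl
  · refine ⟨!![p 0, 1, 0; p 1, 0, 0; p 2, 0, 1], by simpa [Matrix.det_fin_three] using hk, ?_⟩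
    intro i; fin_cases i <;> rfl
  · refine ⟨!![p 0, 1, 0; p 1, 0, 1; p 2, 0, 0], by simpa [Matrix.det_fin_three] using hk, ?_⟩
    intro i; fin_cases i <;> rfl

/-- The linear form `∑ᵤ aᵤ gᵤ` in the components of `g`. -/
abbrev linComb {σ : Type*} (g : Fin 3 → MvPolynomial σ K) (a : Fin 3 → K) : MvPolynomial σ K :=
  ∑ u, C (a u) * g u

/-- The linear substitution `Xᵢ ↦ ∑ⱼ Aᵢⱼ Xⱼ`. -/
def matSubst (A : Matrix (Fin 3) (Fin 3) K) :
    MvPolynomial (Fin 3) K →ₐ[K] MvPolynomial (Fin 3) K :=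
  aeval fun i => linComb X (A i)

theorem aeval_linComb {σ : Type*} (g : Fin 3 → MvPolynomial σ K) (a : Fin 3 → K) :
    aeval g (linComb X a) = linComb g a := by
  simp [linComb, algebraMap_eq]

theorem linComb_linComb {σ : Type*} (g : Fin 3 → MvPolynomial σ K) (A : Matrix (Fin 3) (Fin 3) K)
    (a : Fin 3 → K) : linComb (fun i => linComb g (A i)) a = linComb g (Matrix.vecMul a A) := by
  simp only [linComb, Matrix.vecMul, dotProduct, Finset.mul_sum, map_sum, map_mul, Finset.sum_mul]
  rw [Finset.sum_comm]
  exact Finset.sum_congr rfl fun _ _ => Finset.sum_congr rfl fun _ _ => by ring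

theorem linComb_one {σ : Type*} (g : Fin 3 → MvPolynomial σ K) (i : Fin 3) :
    linComb g ((1 : Matrix (Fin 3) (Fin 3) K) i) = g i := by
  simp [linComb, Matrix.one_apply, apply_ite C]

theorem linComb_linComb_eq {σ : Type*} (g : Fin 3 → MvPolynomial σ K)
    {A B : Matrix (Fin 3) (Fin 3) K} (h : A * B = 1) (i : Fin 3) :
    linComb (fun i => linComb g (B i)) (A i) = g i := by
  rw [linComb_linComb, ← linComb_one g i, ← h]
  rfl

theorem matSubst_matSubst {A B : Matrix (Fin 3) (Fin 3) K} (h : A * B = 1)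
    (p : MvPolynomial (Fin 3) K) : matSubst B (matSubst A p) = p := by
  have : (matSubst B).comp (matSubst A) = AlgHom.id K _ := by
    ext1 i
    simp only [AlgHom.comp_apply, matSubst, aeval_X, AlgHom.id_apply]
    rw [aeval_linComb, linComb_linComb_eq _ h]
  exact DFunLike.congr_fun this p

theorem irreducible_matSubst {A B : Matrix (Fin 3) (Fin 3) K} (h : A * B = 1) (h' : B * A = 1)
    {F : MvPolynomial (Fin 3) K} (hF : Irreducible F) : Irreducible (matSubst A F) := by
  let e : MvPolynomial (Fin 3) K ≃ₐ[K] MvPolynomial (Fin 3) K :=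
    AlgEquiv.ofAlgHom (matSubst A) (matSubst B) (AlgHom.ext fun p => matSubst_matSubst h' p)
      (AlgHom.ext fun p => matSubst_matSubst h p)
  exact (MulEquiv.irreducible_iff e).2 hF

theorem isHomogeneous_linComb {σ : Type*} {g : Fin 3 → MvPolynomial σ K} {n : ℕ}
    (hg : ∀ u, (g u).IsHomogeneous n) (a : Fin 3 → K) : (linComb g a).IsHomogeneous n :=
  IsHomogeneous.sum _ _ _ fun u _ => (hg u).C_mul (a u)

theorem isHomogeneous_matSubst (A : Matrix (Fin 3) (Fin 3) K) {n : ℕ}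
    {F : MvPolynomial (Fin 3) K} (hF : F.IsHomogeneous n) : (matSubst A F).IsHomogeneous n := by
  have h := hF.aeval (n := 1) _ fun i => isHomogeneous_linComb (fun u => isHomogeneous_X K u) (A i)
  rwa [one_mul] at h

theorem aeval_matSubst {σ : Type*} (f : Fin 3 → MvPolynomial σ K) {A B : Matrix (Fin 3) (Fin 3) K}
    (h : A * B = 1) (F : MvPolynomial (Fin 3) K) :
    aeval (fun i => linComb f (B i)) (matSubst A F) = aeval f F := by
  rw [matSubst, ← AlgHom.comp_apply]
  congr 1
  ext1 i
  rw [AlgHom.comp_apply, aeval_X, aeval_X, aeval_linComb, linComb_linComb_eq _ h]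

theorem injective_aeval_of_not_proportional [IsAlgClosed K] {n : ℕ} (hn : 1 ≤ n)
    {a : Fin 2 → MvPolynomial (Fin 2) K} (ha : ∀ i, (a i).IsHomogeneous n)
    (hne : ∀ v : Fin 2 → K, v ≠ 0 → C (v 1) * a 0 - C (v 0) * a 1 ≠ 0) :
    Function.Injective (aeval (R := K) a) := by
  have hhom : ∀ (d : ℕ) (H : MvPolynomial (Fin 2) K), H.IsHomogeneous d → aeval a H = 0 →
      H = 0 := by
    intro d
    induction d with
    | zero =>
      intro H hH h0
      obtain ⟨c, rfl⟩ := exists_eq_C_of_isHomogeneous_zero hH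
      simpa [algebraMap_eq] using h0
    | succ d ih =>
      intro H hH h0
      obtain ⟨v, hv, hv0⟩ := exists_eval_eq_zero hH (by omega)
      obtain ⟨g, hg, rfl⟩ := exists_eq_linFormOf_mul hH hv hv0
      rw [map_mul] at h0
      have h1 : aeval a (linFormOf v) ≠ 0 := by
        simpa [linFormOf, algebraMap_eq] using hne v hv
      rw [ih g hg ((mul_eq_zero.1 h0).resolve_left h1), mul_zero]
  refine (injective_iff_map_eq_zero _).2 fun H h0 => ?_
  rw [← sum_homogeneousComponent H]
  refine Finset.sum_eq_zero fun d _ => hhom d _ (homogeneousComponent_isHomogeneous d H) ?_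
  have h1 := congrArg (homogeneousComponent (n * d)) h0
  conv_lhs at h1 => rw [← sum_homogeneousComponent H]
  rw [map_sum, map_sum, map_zero] at h1
  by_cases hd : d ∈ Finset.range (H.totalDegree + 1)
  · rw [Finset.sum_eq_single_of_mem d hd] at h1
    · rwa [homogeneousComponent_of_mem
        ((homogeneousComponent_isHomogeneous d H).aeval a ha), if_pos rfl] at h1
    · intro e _ hed
      rw [homogeneousComponent_of_mem ((homogeneousComponent_isHomogeneous e H).aeval a ha),
        if_neg]
      intro h2
      exact hed (Nat.eq_of_mul_eq_mul_left hn h2.symm)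
  · rw [homogeneousComponent_eq_zero _ _ (by simpa using hd), map_zero]

theorem aeval_eq_eval₂_finSuccEquiv (f : Fin 3 → MvPolynomial (Fin 2) K)
    (F : MvPolynomial (Fin 3) K) : aeval f F =
      (finSuccEquiv K 2 F).eval₂ (aeval (R := K) fun i => f i.succ : _ →ₐ[K] _).toRingHom (f 0) := by
  induction F using MvPolynomial.induction_on with
  | C a => simp [finSuccEquiv_apply, algebraMap_eq]
  | add p q hp hq => simp only [map_add, hp, hq, Polynomial.eval₂_add]
  | mul_X p i hp =>
    rw [map_mul, map_mul, Polynomial.eval₂_mul, hp, aeval_X]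
    congr 1
    refine Fin.cases ?_ (fun j => ?_) i
    · rw [finSuccEquiv_X_zero, Polynomial.eval₂_X]
    · rw [finSuccEquiv_X_succ, Polynomial.eval₂_C]; simp

theorem linComb_ne_zero [IsAlgClosed K] {n : ℕ} (hn : 3 ≤ n) {f : Fin 3 → MvPolynomial (Fin 2) K}
    (hf : ∀ u, (f u).IsHomogeneous n) (hf0 : ∀ v : Fin 2 → K, v ≠ 0 → evalVec f v ≠ 0)
    {F : MvPolynomial (Fin 3) K} (hFirr : Irreducible F) (hFhom : F.IsHomogeneous n)
    (hFf : aeval f F = 0) {c : Fin 3 → K} (hc : c ≠ 0) : linComb f c ≠ 0 := by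
  intro h0
  obtain ⟨A', B', hAB', hBA', hcol⟩ := exists_matrix_col_eq hc
  set B := A'.transpose
  set A := B'.transpose
  have hAB : A * B = 1 := by rw [← Matrix.transpose_mul, hAB', Matrix.transpose_one]
  have hBA : B * A = 1 := by rw [← Matrix.transpose_mul, hBA', Matrix.transpose_one]
  set f' : Fin 3 → MvPolynomial (Fin 2) K := fun i => linComb f (B i) with hf'
  have hf'h : ∀ i, (f' i).IsHomogeneous n := fun i => isHomogeneous_linComb hf _
  have hf'0 : f' 0 = 0 := by
    rw [← h0]
    exact congrArg (linComb f) (_root_.funext hcol)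
  have hev : ∀ v : Fin 2 → K, v ≠ 0 → ¬ ∀ i, eval v (f' i) = 0 := fun v hv h => by
    refine hf0 v hv (_root_.funext fun i => ?_)
    rw [evalVec, ← linComb_linComb_eq f hAB i]
    change eval v (linComb f' (A i)) = 0
    simp [linComb, h]
  have hinj : Function.Injective (aeval (R := K) fun i : Fin 2 => f' i.succ) := by
    refine injective_aeval_of_not_proportional (by omega) (fun i => hf'h _) fun v hv h => ?_
    obtain ⟨k, hk⟩ := Function.ne_iff.1 hv
    fin_cases k
    · obtain ⟨x, hx, hx0⟩ := exists_eval_eq_zero (hf'h 1) (by omega)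
      refine hev x hx fun i => ?_
      have := congrArg (eval x) h
      have h2 : eval x (f' 2) = 0 := by
        simp [hx0] at this
        exact this.resolve_left hk
      fin_cases i
      · simp [hf'0]
      · exact hx0
      · exact h2
    · obtain ⟨x, hx, hx0⟩ := exists_eval_eq_zero (hf'h 2) (by omega)
      refine hev x hx fun i => ?_
      have := congrArg (eval x) h
      have h2 : eval x (f' 1) = 0 := by
        simp [hx0] at this
        exact this.resolve_left hk
      fin_cases i
      · simp [hf'0]
      · exact h2
      · exact hx0
  have hzero := aeval_matSubst f hAB F
  rw [hFf, aeval_eq_eval₂_finSuccEquiv] at hzero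
  change Polynomial.eval₂ _ (f' 0) _ = 0 at hzero
  rw [hf'0, Polynomial.eval₂_at_zero] at hzero
  have hirr := irreducible_matSubst hAB hBA hFirr
  have hX : X (0 : Fin 3) ∣ matSubst A F := by
    have : Polynomial.X ∣ finSuccEquiv K 2 (matSubst A F) :=
      Polynomial.X_dvd_iff.2 ((map_eq_zero_iff _ hinj).1 hzero)
    rw [← finSuccEquiv_X_zero] at this
    exact (map_dvd_iff (finSuccEquiv K 2)).1 this
  have hassoc := (X_prime (R := K) (i := (0 : Fin 3))).irreducible.associated_of_dvd hirr hX
  obtain ⟨g, hg⟩ := hassoc.symm.dvd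
  have hh := isHomogeneous_matSubst A hFhom
  have h1 : (X (0 : Fin 3) : MvPolynomial (Fin 3) K).totalDegree =
    (matSubst A F).totalDegree + g.totalDegree := by
    rw [hg, totalDegree_mul_of_isDomain hirr.ne_zero]
    rintro rfl
    simp at hg
  rw [hh.totalDegree hirr.ne_zero, totalDegree_X] at h1
  omega

end Independence

section Multiplicity
open scoped Matrix
variable {K : Type*} [Field K]

/-- If `q` is a quadratic form dividing `f₁` and `f₂`, then an irreducible polynomial vanishing at
`(f₀, f₁, f₂)` has degree at most `N` in the first variable, where `N + 2` is the degree of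
the `fᵤ`. -/
theorem degreeOf_zero_le_of_dvd {N : ℕ} {f : Fin 3 → MvPolynomial (Fin 2) K}
    (hf : ∀ u, (f u).IsHomogeneous (N + 2))
    (hinj : Function.Injective (aeval (R := K) fun i : Fin 2 => f i.succ))
    {q : MvPolynomial (Fin 2) K} (hq : q.IsHomogeneous 2) (h1 : q ∣ f 1) (h2 : q ∣ f 2)
    {F : MvPolynomial (Fin 3) K} (hFirr : Irreducible F) (hFf : aeval f F = 0) :
    F.degreeOf 0 ≤ N := by
  by_contra hlt
  push Not at hlt
  obtain ⟨g₁, hg₁⟩ := h1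
  obtain ⟨g₂, hg₂⟩ := h2
  obtain ⟨k₁, hk₁, hf1⟩ := exists_isHomogeneous_of_mul (hf 1) hq (by omega) hg₁
  obtain ⟨k₂, hk₂, hf2⟩ := exists_isHomogeneous_of_mul (hf 2) hq (by omega) hg₂
  rw [Nat.add_sub_cancel] at hk₁ hk₂
  set E := (N + 2) ^ 2 with hE
  set M := N * (E + N + 2) with hM
  have hEN : N ≤ E := by rw [hE]; nlinarith
  let term : Fin (N + 1) → Fin (E + 1) → MvPolynomial (Fin 2) K := fun j a =>
    f 0 ^ (j : ℕ) * q ^ (N - (j : ℕ)) * (k₁ ^ (a : ℕ) * k₂ ^ (E - (a : ℕ) + (N - (j : ℕ))))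
  have hterm : ∀ j a, (term j a).IsHomogeneous M := fun j a => by
    have h := (((hf 0).pow j).mul (hq.pow (N - (j : ℕ)))).mul
      ((hk₁.pow a).mul (hk₂.pow (E - (a : ℕ) + (N - (j : ℕ)))))
    convert h using 1
    obtain ⟨i, hi⟩ := Nat.exists_eq_add_of_le (Nat.lt_succ_iff.1 j.2)
    obtain ⟨b, hb⟩ := Nat.exists_eq_add_of_le (Nat.lt_succ_iff.1 a.2)
    rw [show N - (j : ℕ) = i by omega, show E - (a : ℕ) = b by omega, hM]
    generalize (a : ℕ) = a' at hb
    generalize (j : ℕ) = j' at hi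
    rw [hb, hi]
    ring
  let Φ : (Fin (N + 1) → Fin (E + 1) → K) →ₗ[K] MvPolynomial (Fin 2) K :=
    { toFun := fun α => ∑ j, ∑ a, α j a • term j a
      map_add' := fun α β => by simp [add_smul, Finset.sum_add_distrib]
      map_smul' := fun c α => by simp [Finset.smul_sum, mul_smul] }
  have hΦ : ∀ α, Φ α = ∑ j, ∑ a, α j a • term j a := fun α => rfl
  have hΦh : ∀ α, (Φ α).IsHomogeneous M := fun α =>
    IsHomogeneous.sum _ _ _ fun j _ => IsHomogeneous.sum _ _ _ fun a _ =>
      (homogeneousSubmodule (Fin 2) K M).smul_mem _ (hterm j a)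
  let Ψ : (Fin (N + 1) → Fin (E + 1) → K) →ₗ[K] (Fin (M + 1) → K) :=
    { toFun := fun α => bcoeff M (Φ α)
      map_add' := fun α β => by funext i; simp [bcoeff]
      map_smul' := fun c α => by funext i; simp [bcoeff] }
  have hΨ : Function.Injective Ψ := by
    refine (injective_iff_map_eq_zero _).2 fun α hα => ?_
    have h0 : Φ α = 0 := by
      rw [← formOf_bcoeff (hΦh α), show bcoeff M (Φ α) = 0 from hα]
      simp [formOf]
    let coef : Fin (N + 1) → MvPolynomial (Fin 2) K := fun j =>
      X 1 ^ (N - (j : ℕ)) * formOf E (fun i => α j i.rev)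
    let G : Polynomial (MvPolynomial (Fin 2) K) :=
      ∑ j : Fin (N + 1), Polynomial.C (coef j) * Polynomial.X ^ (j : ℕ)
    have hcoef : ∀ j, aeval (R := K) (fun i : Fin 2 => f i.succ) (coef j) * f 0 ^ (j : ℕ) =
        q ^ E * ∑ a, α j a • term j a := fun j => by
      have hsum : formOf E (fun i => α j i.rev) =
          ∑ a : Fin (E + 1), C (α j a) * X 0 ^ (a : ℕ) * X 1 ^ (E - (a : ℕ)) := by
        rw [formOf, ← Equiv.sum_comp Fin.revPerm]
        refine Finset.sum_congr rfl fun a _ => ?_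
        have ha := Nat.lt_succ_iff.1 a.2
        simp only [Fin.revPerm_apply, Fin.rev_rev, Fin.val_rev]
        rw [show E - (E + 1 - ((a : ℕ) + 1)) = a by omega,
          show E + 1 - ((a : ℕ) + 1) = E - a by omega]
      simp only [coef, hsum, map_mul, map_sum, map_pow, aeval_X, aeval_C, Finset.mul_sum,
        Finset.sum_mul, algebraMap_eq]
      refine Finset.sum_congr rfl fun a _ => ?_
      obtain ⟨b, hb⟩ := Nat.exists_eq_add_of_le (Nat.lt_succ_iff.1 a.2)
      rw [show (Fin.succ (0 : Fin 2)) = 1 from rfl, show (Fin.succ (1 : Fin 2)) = 2 from rfl,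
        hf1, hf2, smul_eq_C_mul, show E - (a : ℕ) = b by omega]
      simp only [term]
      rw [show E - (a : ℕ) = b by omega]
      have hqE : q ^ E = q ^ (a : ℕ) * q ^ b := by rw [← pow_add, ← hb]
      rw [hqE]
      ring
    have hG0 : G = 0 := by
      refine Polynomial.eq_zero_of_eval₂_eq_zero_of_natDegree_lt (p := finSuccEquiv K 2 F)
        (φ := (aeval (R := K) fun i : Fin 2 => f i.succ : _ →ₐ[K] _).toRingHom) (y := f 0)
        hinj ((MulEquiv.irreducible_iff (finSuccEquiv K 2)).2 hFirr) ?_ ?_ ?_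
      · rw [← aeval_eq_eval₂_finSuccEquiv, hFf]
      · simp only [G, Polynomial.eval₂_finsetSum, Polynomial.eval₂_mul, Polynomial.eval₂_C,
          Polynomial.eval₂_pow, Polynomial.eval₂_X]
        refine (Finset.sum_congr rfl fun j _ => hcoef j).trans ?_
        rw [← Finset.mul_sum, ← hΦ, h0, mul_zero]
      · rw [natDegree_finSuccEquiv]
        refine lt_of_le_of_lt ?_ hlt
        refine Polynomial.natDegree_sum_le_of_forall_le _ _ fun j _ => ?_
        exact (Polynomial.natDegree_C_mul_X_pow_le _ _).trans (Nat.lt_succ_iff.1 j.2)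
    funext j a
    have hj : coef j = 0 := by
      have := congrArg (fun p => Polynomial.coeff p (j : ℕ)) hG0
      simpa [G, Polynomial.finsetSum_coeff, Polynomial.coeff_X_pow, Fin.val_inj] using this
    have := formOf_eq_zero ((mul_eq_zero.1 hj).resolve_left (pow_ne_zero _ (X_ne_zero _)))
    simpa using congrFun this a.rev
  have hdim := LinearMap.finrank_le_finrank_of_injective hΨ
  simp only [Module.finrank_pi_fintype, Module.finrank_self, Finset.sum_const, Finset.card_univ,
    Fintype.card_fin, smul_eq_mul, mul_one] at hdim
  rw [hM, hE] at hdim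
  nlinarith

theorem mem_pointIdeal_pow_of_degreeOf_le {N : ℕ} {F : MvPolynomial (Fin 3) K} {p : Fin 3 → K}
    {A B : Matrix (Fin 3) (Fin 3) K} (hAB : A * B = 1) (hBA : B * A = 1) (hp : ∀ i, A i 0 = p i)
    (hF : F.IsHomogeneous (N + 2)) (hdeg : (matSubst A F).degreeOf 0 ≤ N) :
    F ∈ pointIdeal p ^ 2 := by
  rw [← matSubst_matSubst hAB F, (matSubst A F).as_sum, map_sum]
  refine Ideal.sum_mem _ fun d hd => ?_
  have hd0 : d 0 ≤ N := (degreeOf_le_iff.1 hdeg) d hd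
  have hdsum : d 0 + d 1 + d 2 = N + 2 := by
    by_contra hne
    refine mem_support_iff.1 hd ((isHomogeneous_matSubst A hF).coeff_eq_zero ?_)
    rwa [Finsupp.degree_eq_sum, Fin.sum_univ_three]
  have hL : ∀ i : Fin 3, i ≠ 0 → linComb X (B i) ∈ pointIdeal p := fun i hi => by
    refine Ideal.subset_span ⟨isHomogeneous_linComb (fun u => isHomogeneous_X K u) _, ?_⟩
    have : eval p (linComb X (B i)) = (B * A) i 0 := by
      simp [linComb, Matrix.mul_apply, hp]
    rw [this, hBA, Matrix.one_apply_ne hi]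
  rw [matSubst, aeval_monomial, Finsupp.prod_fintype _ _ (by simp), Fin.prod_univ_three]
  have h12 : linComb X (B 1) ^ d 1 * linComb X (B 2) ^ d 2 ∈ pointIdeal p ^ 2 := by
    refine Ideal.pow_le_pow_right (show 2 ≤ d 1 + d 2 by omega) ?_
    rw [pow_add]
    exact Ideal.mul_mem_mul (Ideal.pow_mem_pow (hL 1 (by simp)) _)
      (Ideal.pow_mem_pow (hL 2 (by simp)) _)
  rw [mul_assoc (linComb X (B 0) ^ d 0)]
  exact Ideal.mul_mem_left _ _ (Ideal.mul_mem_left _ _ h12)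

theorem bddAbove_setOf_mem_pointIdeal_pow [Infinite K] {F : MvPolynomial (Fin 3) K} (hF : F ≠ 0)
    (p : Fin 3 → K) : BddAbove {m | F ∈ pointIdeal p ^ m} := by
  obtain ⟨x, hx⟩ : ∃ x, eval x F ≠ 0 := by
    by_contra h
    push Not at h
    exact hF (MvPolynomial.funext fun x => by rw [h x, map_zero])
  let ψ : MvPolynomial (Fin 3) K →ₐ[K] Polynomial K :=
    aeval fun u => Polynomial.C (p u) + Polynomial.C (x u - p u) * Polynomial.X
  have hψ : ∀ a h, (ψ h).eval a = eval (fun u => p u + (x u - p u) * a) h := fun a h => by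
    induction h using MvPolynomial.induction_on with
    | C c => simp [ψ]
    | add g h hg hh => simp only [map_add, Polynomial.eval_add, hg, hh]
    | mul_X g i hg => simp only [map_mul, Polynomial.eval_mul, hg]; simp [ψ]
  have hle : (pointIdeal p).map ψ ≤ Ideal.span {Polynomial.X} := by
    rw [pointIdeal, Ideal.map_span, Ideal.span_le]
    rintro _ ⟨L, ⟨-, hL⟩, rfl⟩
    rw [SetLike.mem_coe, Ideal.mem_span_singleton, Polynomial.X_dvd_iff,
      Polynomial.coeff_zero_eq_eval_zero]
    simpa [hψ] using hL
  have hψF : ψ F ≠ 0 := fun h0 => hx (by simpa [hψ] using congrArg (Polynomial.eval 1) h0)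
  refine ⟨(ψ F).natDegree, fun m hm => ?_⟩
  have h1 : ψ F ∈ Ideal.span {(Polynomial.X : Polynomial K)} ^ m := by
    refine Ideal.pow_right_mono hle m ?_
    rw [← Ideal.map_pow]
    exact Ideal.mem_map_of_mem ψ hm
  rw [Ideal.span_singleton_pow, Ideal.mem_span_singleton] at h1
  simpa using Polynomial.natDegree_le_of_dvd h1 hψF

theorem two_le_multAt [IsAlgClosed K] {N : ℕ} (hN : 1 ≤ N) {f : Fin 3 → MvPolynomial (Fin 2) K}
    (hf : ∀ u, (f u).IsHomogeneous (N + 2)) (hf0 : ∀ v : Fin 2 → K, v ≠ 0 → evalVec f v ≠ 0)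
    {F : MvPolynomial (Fin 3) K} (hFirr : Irreducible F) (hFhom : F.IsHomogeneous (N + 2))
    (hFf : aeval f F = 0) {p : Fin 3 → K} (hp : p ≠ 0) {q : MvPolynomial (Fin 2) K}
    (hq : q.IsHomogeneous 2) (hdvd : ∀ c : Fin 3 → K, c ⬝ᵥ p = 0 → q ∣ linComb f c) :
    2 ≤ multAt F p := by
  obtain ⟨A, B, hAB, hBA, hcol⟩ := exists_matrix_col_eq hp
  have hperp : ∀ i : Fin 3, i ≠ 0 → B i ⬝ᵥ p = 0 := fun i hi => by
    have : B i ⬝ᵥ p = (B * A) i 0 := by simp [Matrix.mul_apply, dotProduct, hcol]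
    rw [this, hBA, Matrix.one_apply_ne hi]
  have hinj : Function.Injective (aeval (R := K) fun i : Fin 2 => linComb f (B i.succ)) := by
    refine injective_aeval_of_not_proportional (show 1 ≤ N + 2 by omega)
      (fun i => isHomogeneous_linComb hf _) fun v hv h => ?_
    have h1 : linComb f (v 1 • B 1 - v 0 • B 2) = 0 := by
      rw [← h]
      simp only [linComb, Finset.mul_sum, ← Finset.sum_sub_distrib]
      refine Finset.sum_congr rfl fun u _ => ?_
      simp
      ring
    have h2 : v 1 • B 1 - v 0 • B 2 = 0 := by
      by_contra h2
      exact linComb_ne_zero (by omega) hf hf0 hFirr hFhom hFf h2 h1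
    have h3 : ∀ j, v 1 * (B * A) 1 j - v 0 * (B * A) 2 j = 0 := fun j => by
      have : v 1 * (B * A) 1 j - v 0 * (B * A) 2 j =
          ((v 1 • B 1 - v 0 • B 2) ᵥ* A) j := by
        simp only [Matrix.mul_apply, Matrix.vecMul, dotProduct, Fin.sum_univ_three, Pi.sub_apply,
          Pi.smul_apply, smul_eq_mul]
        ring
      rw [this, h2, Matrix.zero_vecMul, Pi.zero_apply]
    rw [hBA] at h3
    apply hv
    funext i
    fin_cases i
    · simpa [Matrix.one_apply] using h3 2
    · simpa [Matrix.one_apply] using h3 1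
  refine le_csSup (bddAbove_setOf_mem_pointIdeal_pow hFirr.ne_zero p) ?_
  refine mem_pointIdeal_pow_of_degreeOf_le hAB hBA hcol hFhom ?_
  refine degreeOf_zero_le_of_dvd (f := fun i => linComb f (B i))
    (fun i => isHomogeneous_linComb hf _) hinj hq (hdvd _ (hperp 1 (by simp)))
    (hdvd _ (hperp 2 (by simp))) (irreducible_matSubst hAB hBA hFirr) ?_
  rw [aeval_matSubst f hAB, hFf]

end Multiplicity

section Ordinary
open scoped Matrix
variable {K : Type*} [Field K]

theorem eval_linComb (f : Fin 3 → MvPolynomial (Fin 2) K) (c : Fin 3 → K) (v : Fin 2 → K) :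
    eval v (linComb f c) = c ⬝ᵥ evalVec f v := by
  simp [linComb, dotProduct, evalVec]

theorem exists_eq_smul_of_forall_dotProduct {p x : Fin 3 → K} (hp : p ≠ 0)
    (h : ∀ c : Fin 3 → K, c ⬝ᵥ p = 0 → c ⬝ᵥ x = 0) : ∃ l : K, x = l • p := by
  refine Polynomial.exists_eq_smul_of_cross_eq_zero hp (dotProduct_eq_zero _ fun y => ?_)
  rw [dotProduct_comm, triple_product_permutation, triple_product_permutation, dotProduct_comm]
  exact h _ (by rw [dotProduct_comm, dot_cross_self])

theorem evalVec_smul {n : ℕ} {f : Fin 3 → MvPolynomial (Fin 2) K}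
    (hf : ∀ u, (f u).IsHomogeneous n) (d : K) (v : Fin 2 → K) :
    evalVec f (d • v) = d ^ n • evalVec f v := by
  funext u
  have h1 := congrArg (Polynomial.eval d) (chartMap_zero_of_isHomogeneous (hf u) v)
  rw [eval_chartMap, zero_add] at h1
  rw [evalVec, h1, Pi.smul_apply, smul_eq_mul, evalVec]
  rw [Polynomial.eval_mul, Polynomial.eval_C, Polynomial.eval_pow, Polynomial.eval_X, mul_comm]

theorem dvd_crossDiff_iff {f : Fin 3 → MvPolynomial (Fin 2) K} {p : Fin 3 → K} (hp : p ≠ 0)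
    (q : MvPolynomial (Fin 2) K) : (∀ i j : Fin 3, i < j → q ∣ crossDiff f p i j) ↔
      ∀ c : Fin 3 → K, c ⬝ᵥ p = 0 → q ∣ linComb f c := by
  constructor
  · intro h c hc
    obtain ⟨k, hk⟩ := Function.ne_iff.1 hp
    have h1 : ∀ u, q ∣ crossDiff f p k u := fun u => by
      rcases lt_trichotomy k u with hlt | rfl | hlt
      · exact h _ _ hlt
      · simp [crossDiff]
      · rw [crossDiff, ← neg_sub]
        exact (h _ _ hlt).neg_right
    have h2 : linComb f c = C (p k)⁻¹ * ∑ u, C (c u) * crossDiff f p k u := by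
      have h3 : ∑ u, C (c u) * crossDiff f p k u = C (p k) * linComb f c - C (c ⬝ᵥ p) * f k := by
        simp only [crossDiff, linComb, dotProduct, Fin.sum_univ_three, map_add, map_mul]
        ring
      rw [h3, hc, map_zero, zero_mul, sub_zero, ← mul_assoc, ← map_mul, inv_mul_cancel₀ hk,
        map_one, one_mul]
    rw [h2]
    exact (Finset.dvd_sum fun u _ => (h1 u).mul_left _).mul_left _
  · intro h i j _
    have h1 : crossDiff f p i j = linComb f (Pi.single j (p i) - Pi.single i (p j)) := by
      simp only [crossDiff, linComb, Pi.sub_apply, map_sub, sub_mul, Finset.sum_sub_distrib]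
      congr 1 <;> simp [Pi.single_apply, apply_ite C]
    rw [h1]
    refine h _ ?_
    rw [sub_dotProduct]
    simp [mul_comm]

theorem exists_isGcdOfCross (f : Fin 3 → MvPolynomial (Fin 2) K) (p : Fin 3 → K) :
    ∃ G, IsGcdOfCross f p G := by
  let _ := UniqueFactorizationMonoid.toGCDMonoid (MvPolynomial (Fin 2) K)
  refine ⟨gcd (crossDiff f p 0 1) (gcd (crossDiff f p 0 2) (crossDiff f p 1 2)), ?_, fun D hD => ?_⟩
  · intro i j hij
    have h01 := gcd_dvd_left (crossDiff f p 0 1) (gcd (crossDiff f p 0 2) (crossDiff f p 1 2))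
    have h := gcd_dvd_right (crossDiff f p 0 1) (gcd (crossDiff f p 0 2) (crossDiff f p 1 2))
    have h02 := h.trans (gcd_dvd_left _ _)
    have h12 := h.trans (gcd_dvd_right _ _)
    fin_cases i <;> fin_cases j <;> first | exact h01 | exact h02 | exact h12 | simp at hij
  · exact dvd_gcd (hD _ _ (by simp)) (dvd_gcd (hD _ _ (by simp)) (hD _ _ (by decide)))

theorem two_le_ordAt_iff {v : Fin 2 → K} (hv : v ≠ 0) {h : MvPolynomial (Fin 2) K} (h0 : h ≠ 0) :
    2 ≤ ordAt v h ↔ linFormOf v ^ 2 ∣ h := by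
  have hbdd : BddAbove {e | linFormOf v ^ e ∣ h} := by
    obtain ⟨m, hm⟩ := FiniteMultiplicity.of_prime_left (prime_linFormOf hv) h0
    refine ⟨m, fun e he => ?_⟩
    by_contra hlt
    exact hm ((pow_dvd_pow _ (by omega)).trans he)
  constructor
  · intro h2
    have : ordAt v h ∈ {e | linFormOf v ^ e ∣ h} := Nat.sSup_mem ⟨0, by simp⟩ hbdd
    exact (pow_dvd_pow _ h2).trans this
  · exact fun h2 => le_csSup hbdd h2

/-- Every branch of the parameterized curve is smooth. -/
def IsImmersed (f : Fin 3 → MvPolynomial (Fin 2) K) : Prop :=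
  ∀ v : Fin 2 → K, v ≠ 0 → ¬ ∀ c : Fin 3 → K, c ⬝ᵥ evalVec f v = 0 → linFormOf v ^ 2 ∣ linComb f c

/-- No line is tangent to two distinct branches through the same point. -/
def HasDistinctTangents (f : Fin 3 → MvPolynomial (Fin 2) K) : Prop :=
  ∀ v w : Fin 2 → K, v ≠ 0 → w ≠ 0 → (∀ d : K, w ≠ d • v) → evalVec f v ⨯₃ evalVec f w = 0 →
    ∀ c : Fin 3 → K, c ≠ 0 → linFormOf v ^ 2 ∣ linComb f c → ¬ linFormOf w ^ 2 ∣ linComb f c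

variable {n : ℕ} {f : Fin 3 → MvPolynomial (Fin 2) K}

theorem linFormOf_mul_dvd_linComb_iff (hf : ∀ u, (f u).IsHomogeneous n) {v w : Fin 2 → K}
    (hvw : v 1 * w 0 - v 0 * w 1 ≠ 0) (hfv : evalVec f v ≠ 0) :
    (∀ c : Fin 3 → K, c ⬝ᵥ evalVec f v = 0 → linFormOf v * linFormOf w ∣ linComb f c) ↔
      evalVec f v ⨯₃ evalVec f w = 0 := by
  simp only [linFormOf_mul_dvd_iff (isHomogeneous_linComb hf _) hvw, eval_linComb]
  constructor
  · intro h
    obtain ⟨l, hl⟩ := exists_eq_smul_of_forall_dotProduct hfv fun c hc => (h c hc).2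
    simp [hl]
  · intro h c hc
    obtain ⟨l, hl⟩ := Polynomial.exists_eq_smul_of_cross_eq_zero hfv h
    simp [hl, hc]

theorem det_ne_zero_of_forall_ne_smul {v w : Fin 2 → K} (hv : v ≠ 0) (h : ∀ d : K, w ≠ d • v) :
    v 1 * w 0 - v 0 * w 1 ≠ 0 := fun h0 => by
  obtain ⟨d, hd⟩ := exists_smul_of_det_eq_zero hv h0
  exact h d hd

theorem onlyOrdinarySing_iff [IsAlgClosed K] (hf : ∀ u, (f u).IsHomogeneous n)
    (hf0 : ∀ v : Fin 2 → K, v ≠ 0 → evalVec f v ≠ 0) {F : MvPolynomial (Fin 3) K}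
    (hnd : ∀ c : Fin 3 → K, c ≠ 0 → linComb f c ≠ 0)
    (hmult : ∀ (p : Fin 3 → K) (q : MvPolynomial (Fin 2) K), p ≠ 0 → q.IsHomogeneous 2 →
      (∀ c : Fin 3 → K, c ⬝ᵥ p = 0 → q ∣ linComb f c) → 2 ≤ multAt F p) :
    OnlyOrdinarySing f F ↔ IsImmersed f ∧ HasDistinctTangents f := by
  constructor
  · intro hord
    constructor
    · intro v hv h
      obtain ⟨G, hG⟩ := exists_isGcdOfCross f (evalVec f v)
      have h2 := hmult _ _ (hf0 v hv) ((isHomogeneous_linFormOf v).pow 2) h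
      have hsq := (hord _ (hf0 v hv) h2 G hG).1
      have hdvd := hG.2 _ ((dvd_crossDiff_iff (hf0 v hv) _).2 h)
      exact (prime_linFormOf hv).not_isUnit (hsq _ (by rwa [← sq]))
    · intro v w hv hw hvw hcross c hc hcv hcw
      have h := (linFormOf_mul_dvd_linComb_iff hf (det_ne_zero_of_forall_ne_smul hv hvw)
        (hf0 v hv)).2 hcross
      obtain ⟨G, hG⟩ := exists_isGcdOfCross f (evalVec f v)
      have h2 := hmult _ _ (hf0 v hv) ((isHomogeneous_linFormOf v).mul (isHomogeneous_linFormOf w)) h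
      obtain ⟨g, rfl⟩ := hG.2 _ ((dvd_crossDiff_iff (hf0 v hv) _).2 h)
      refine (hord _ (hf0 v hv) h2 _ hG).2 v w hv hw ?_ ?_ hvw
        ⟨c, hc, (two_le_ordAt_iff hv (hnd c hc)).2 hcv, (two_le_ordAt_iff hw (hnd c hc)).2 hcw⟩
      · simp [mul_comm]
      · simp [mul_comm]
  · rintro ⟨himm, htan⟩ p hp - G hG
    have hGdvd := (dvd_crossDiff_iff hp G).1 hG.1
    have hline : ∀ v : Fin 2 → K, eval v G = 0 → ∃ l : K, evalVec f v = l • p := fun v hv =>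
      exists_eq_smul_of_forall_dotProduct hp fun c hc => by
        obtain ⟨g, hg⟩ := hGdvd c hc
        rw [← eval_linComb, hg, map_mul, hv, zero_mul]
    constructor
    · intro g hgg
      by_contra hg
      obtain ⟨c, hc, hcp⟩ := exists_ne_zero_dotProduct_eq_zero p
      obtain ⟨v, hv, hvg⟩ := exists_linFormOf_dvd_of_dvd (isHomogeneous_linComb hf c) (hnd c hc) hg
        ((dvd_mul_right g g).trans (hgg.trans (hGdvd c hcp)))
      have hvG : linFormOf v ^ 2 ∣ G := by
        rw [sq]
        exact (mul_dvd_mul hvg hvg).trans hgg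
      obtain ⟨l, hl⟩ := hline v (by
        obtain ⟨k, rfl⟩ := hvG
        simp [mul_comm])
      refine himm v hv fun c hc => hvG.trans (hGdvd c ?_)
      have hl0 : l ≠ 0 := by
        rintro rfl
        exact hf0 v hv (by rw [hl, zero_smul])
      rw [hl, dotProduct_smul, smul_eq_mul] at hc
      exact (mul_eq_zero.1 hc).resolve_left hl0
    · rintro v w hv hw hvG hwG hvw ⟨c, hc, hcv, hcw⟩
      obtain ⟨l, hl⟩ := hline v hvG
      obtain ⟨m, hm⟩ := hline w hwG
      exact htan v w hv hw hvw (by simp [hl, hm]) c hc ((two_le_ordAt_iff hv (hnd c hc)).1 hcv)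
        ((two_le_ordAt_iff hw (hnd c hc)).1 hcw)

theorem pairVec_ne_zero {v w : Fin 2 → K} (hv : v ≠ 0) (hw : w ≠ 0) : pairVec v w ≠ 0 := fun h => by
  refine mul_ne_zero (linFormOf_ne_zero hv) (linFormOf_ne_zero hw) ?_
  rw [← formOf_pairVec, h]
  simp [formOf]

theorem pairVec_smul_right (v w : Fin 2 → K) (k : K) : pairVec v (k • w) = k • pairVec v w := by
  funext i
  fin_cases i <;> simp [pairVec] <;> ring

theorem pairVec_comm (v w : Fin 2 → K) : pairVec v w = pairVec w v := by
  funext i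
  fin_cases i <;> simp [pairVec] <;> ring

theorem exists_eq_mk_pairVec [IsAlgClosed K] (P : Projectivization K (Fin 3 → K)) :
    ∃ (v w : Fin 2 → K) (hv : v ≠ 0) (hw : w ≠ 0),
      P = Projectivization.mk K (pairVec v w) (pairVec_ne_zero hv hw) := by
  obtain ⟨v, w, hv, hw, h⟩ := exists_eq_pairVec P.rep_nonzero
  refine ⟨v, w, hv, hw, ?_⟩
  conv_lhs => rw [← P.mk_rep]
  congr 1

variable {N : ℕ}

theorem mk_pairVec_mem_XkSet_iff (hf : ∀ u, (f u).IsHomogeneous (N + 2))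
    (hf0 : ∀ v : Fin 2 → K, v ≠ 0 → evalVec f v ≠ 0) {v w : Fin 2 → K} (hv : v ≠ 0) (hw : w ≠ 0) :
    Projectivization.mk K (pairVec v w) (pairVec_ne_zero hv hw) ∈ XkSet (N + 2) 2 f ↔
      ∀ c : Fin 3 → K, c ⬝ᵥ evalVec f v = 0 → linFormOf v * linFormOf w ∣ linComb f c := by
  obtain ⟨a, ha⟩ := Projectivization.exists_smul_eq_mk_rep K (pairVec v w) (pairVec_ne_zero hv hw)
  have ha' : (Projectivization.mk K (pairVec v w) (pairVec_ne_zero hv hw)).rep =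
      pairVec v ((a : K) • w) := by
    rw [← ha, pairVec_smul_right]; rfl
  have hu : IsUnit (C (a : K) : MvPolynomial (Fin 2) K) := a.isUnit.map C
  rw [XkSet, Set.mem_ofPred_eq, ha', forall_minors_eq_zero_iff_dvd hf hv
    (smul_ne_zero a.ne_zero hw) (hf0 v hv), linFormOf_smul, mul_left_comm]
  simp only [hu.mul_left_dvd]

theorem forall_not_onConic_iff [IsAlgClosed K] (hf : ∀ u, (f u).IsHomogeneous (N + 2))
    (hf0 : ∀ v : Fin 2 → K, v ≠ 0 → evalVec f v ≠ 0) :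
    (∀ P ∈ XkSet (N + 2) 2 f, ¬ onConic (Projectivization.rep P)) ↔ IsImmersed f := by
  have hconic : ∀ {v w : Fin 2 → K} (hv : v ≠ 0) (hw : w ≠ 0),
      onConic (Projectivization.mk K (pairVec v w) (pairVec_ne_zero hv hw)).rep ↔
        v 1 * w 0 - v 0 * w 1 = 0 := fun {v w} hv hw => by
    obtain ⟨a, ha⟩ := Projectivization.exists_smul_eq_mk_rep K (pairVec v w) (pairVec_ne_zero hv hw)
    rw [← ha, ← onConic_pairVec_iff]
    exact onConic_smul_iff a.ne_zero _
  constructor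
  · intro h v hv hdvd
    refine h _ ((mk_pairVec_mem_XkSet_iff hf hf0 hv hv).2 fun c hc => ?_)
      ((hconic hv hv).2 (by ring))
    rw [← sq]
    exact hdvd c hc
  · intro himm P hP hPc
    obtain ⟨v, w, hv, hw, rfl⟩ := exists_eq_mk_pairVec P
    obtain ⟨d, rfl⟩ := exists_smul_of_det_eq_zero hv ((hconic hv hw).1 hPc)
    refine himm v hv fun c hc => ?_
    refine Dvd.dvd.trans ?_ ((mk_pairVec_mem_XkSet_iff hf hf0 hv hw).1 hP c hc)
    rw [linFormOf_smul, sq, mul_left_comm]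
    exact dvd_mul_left _ _

end Ordinary

section Chart
open scoped Matrix
open Polynomial (vecEval vecCoeff vecDeriv vecC IsImmersedChart)
variable {K : Type*} [Field K] {N : ℕ} {f : Fin 3 → MvPolynomial (Fin 2) K}

theorem Projectivization.mk_mem_or_mk_mem_of_cross_eq_zero {n : ℕ}
    (hf : ∀ u, (f u).IsHomogeneous n)
    (hf0 : ∀ v : Fin 2 → K, v ≠ 0 → evalVec f v ≠ 0) {S : Set (Projectivization K (Fin 2 → K))}
    (hS : Set.InjOn (projMap f) Sᶜ) {v w : Fin 2 → K} (hv : v ≠ 0) (hw : w ≠ 0)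
    (hvw : ∀ d : K, w ≠ d • v) (hcross : evalVec f v ⨯₃ evalVec f w = 0) :
    Projectivization.mk K v hv ∈ S ∨ Projectivization.mk K w hw ∈ S := by
  by_contra! hnot
  obtain ⟨a, ha⟩ := Projectivization.exists_smul_eq_mk_rep K v hv
  obtain ⟨b, hb⟩ := Projectivization.exists_smul_eq_mk_rep K w hw
  obtain ⟨l, hl⟩ := Polynomial.exists_eq_smul_of_cross_eq_zero (hf0 v hv) hcross
  have hl0 : l ≠ 0 := by
    rintro rfl
    exact hf0 w hw (by rw [hl, zero_smul])
  have heq : projMap f (Projectivization.mk K v hv) = projMap f (Projectivization.mk K w hw) := by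
    rw [projMap, projMap, dif_pos (hf0 _ (Projectivization.rep_nonzero _)),
      dif_pos (hf0 _ (Projectivization.rep_nonzero _)), Projectivization.mk_eq_mk_iff']
    refine ⟨(a : K) ^ n * ((b : K) ^ n * l)⁻¹, ?_⟩
    rw [← ha, ← hb, Units.smul_def, Units.smul_def, evalVec_smul hf, evalVec_smul hf, hl,
      smul_smul, smul_smul]
    congr 1
    have := pow_ne_zero n b.ne_zero
    field_simp
  obtain ⟨d, hd⟩ := (Projectivization.mk_eq_mk_iff' K _ _ hw hv).1 (hS hnot.1 hnot.2 heq).symm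
  exact hvw d hd.symm

theorem exists_forall_cross_ne_zero [Infinite K] {n : ℕ} (hf : ∀ u, (f u).IsHomogeneous n)
    (hf0 : ∀ v : Fin 2 → K, v ≠ 0 → evalVec f v ≠ 0)
    (hnd : ∀ c : Fin 3 → K, c ≠ 0 → linComb f c ≠ 0)
    {S : Set (Projectivization K (Fin 2 → K))} (hSfin : S.Finite)
    (hS : Set.InjOn (projMap f) Sᶜ) :
    ∃ τ : K, ∀ w : Fin 2 → K, w ≠ 0 → (∀ d : K, w ≠ d • ![1, τ]) →
      evalVec f ![1, τ] ⨯₃ evalVec f w ≠ 0 := by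
  have hne : ∀ τ : K, ![1, τ] ≠ 0 := fun τ h => by simpa using congrFun h 0
  have h1 : {τ : K | Projectivization.mk K ![1, τ] (hne τ) ∈ S}.Finite := by
    refine hSfin.preimage fun τ _ σ _ h => ?_
    obtain ⟨d, hd⟩ := (Projectivization.mk_eq_mk_iff' K _ _ _ _).1 h
    have h0 := congrFun hd 0
    have h1 := congrFun hd 1
    simp at h0 h1
    rw [← h1, h0, one_mul]
  have h2 : ∀ Q ∈ S, {τ : K | evalVec f ![1, τ] ⨯₃ evalVec f Q.rep = 0}.Finite := fun Q _ => by
    obtain ⟨c, hc, hcQ⟩ := exists_ne_zero_dotProduct_eq_zero (evalVec f Q.rep)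
    have hpoly : chartMap ![1, 0] ![0, 1] (linComb f c) ≠ 0 := fun h0 => hnd c hc <|
      chartMap_eq_zero (isHomogeneous_linComb hf c) (by simp) h0
    refine (Polynomial.finite_setOfPred_isRoot hpoly).subset fun τ hτ => ?_
    rw [Set.mem_ofPred_eq, ← cross_anticomm, neg_eq_zero] at hτ
    obtain ⟨l, hl⟩ := Polynomial.exists_eq_smul_of_cross_eq_zero (hf0 _ Q.rep_nonzero) hτ
    rw [Set.mem_ofPred_eq, Polynomial.IsRoot, eval_chartMap,
      show (![1, 0] + τ • ![0, 1] : Fin 2 → K) = ![1, τ] by simp, eval_linComb, hl,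
      dotProduct_smul, hcQ, smul_zero]
  obtain ⟨τ, hτ⟩ := (h1.union (hSfin.biUnion h2)).exists_notMem
  refine ⟨τ, fun w hw hvw hcross => hτ ?_⟩
  rcases Projectivization.mk_mem_or_mk_mem_of_cross_eq_zero hf hf0 hS (hne τ) hw hvw hcross with
    h | h
  · exact Or.inl h
  · refine Or.inr (Set.mem_biUnion h ?_)
    obtain ⟨b, hb⟩ := Projectivization.exists_smul_eq_mk_rep K w hw
    rw [Set.mem_ofPred_eq, ← hb, Units.smul_def, evalVec_smul hf, map_smul, hcross, smul_zero]

theorem exists_eq_smul_add_smul {e₁ e₂ : Fin 2 → K} (hδ : e₁ 1 * e₂ 0 - e₁ 0 * e₂ 1 ≠ 0)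
    {v : Fin 2 → K} (hv : ∀ d : K, v ≠ d • e₂) :
    ∃ d a : K, d ≠ 0 ∧ v = d • (e₁ + a • e₂) := by
  have he := det_ne_zero_of_forall_ne_smul (ne_zero_of_det_ne_zero hδ) hv
  set δ := e₁ 1 * e₂ 0 - e₁ 0 * e₂ 1 with hδd
  have hd : (v 1 * e₂ 0 - v 0 * e₂ 1) ≠ 0 := fun h => he (by linear_combination -h)
  refine ⟨(v 1 * e₂ 0 - v 0 * e₂ 1) / δ,
    (e₁ 1 * v 0 - e₁ 0 * v 1) / (v 1 * e₂ 0 - v 0 * e₂ 1), div_ne_zero hd hδ, ?_⟩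
  funext i
  fin_cases i
  · simp only [Pi.smul_apply, Pi.add_apply, smul_eq_mul, Fin.zero_eta]
    field_simp
    rw [hδd]; ring
  · simp only [Pi.smul_apply, Pi.add_apply, smul_eq_mul, Fin.mk_one]
    field_simp
    rw [hδd]; ring

theorem Finset.card_eq_two_mul_card_image {α β : Type*} [DecidableEq α] [DecidableEq β]
    {D : Finset (α × α)} (hsymm : ∀ q ∈ D, q.swap ∈ D) (hirr : ∀ q ∈ D, q.2 ≠ q.1)
    {g : α × α → β} (hg : ∀ p ∈ D, ∀ q ∈ D, g q = g p ↔ q = p ∨ q = p.swap) :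
    D.card = 2 * (D.image g).card := by
  rw [mul_comm, Finset.card_eq_sum_card_image g D]
  refine Finset.sum_const_nat fun b hb => ?_
  obtain ⟨p, hp, rfl⟩ := Finset.mem_image.1 hb
  have : D.filter (fun q => g q = g p) = {p, p.swap} := by
    ext q
    simp only [Finset.mem_filter, Finset.mem_insert, Finset.mem_singleton]
    constructor
    · rintro ⟨hq, h⟩
      exact (hg p hp q hq).1 h
    · intro h
      have hq : q ∈ D := by
        rcases h with rfl | rfl
        · exact hp
        · exact hsymm _ hp
      exact ⟨hq, (hg p hp q hq).2 h⟩
  rw [this, Finset.card_pair]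
  intro h
  exact hirr p hp (congrArg Prod.fst h).symm

/-- The parameterization in the affine chart `a ↦ e₁ + a e₂` of the projective line. -/
def chartVec (f : Fin 3 → MvPolynomial (Fin 2) K) (e₁ e₂ : Fin 2 → K) : Fin 3 → Polynomial K :=
  fun u => chartMap e₁ e₂ (f u)

variable {e₁ e₂ : Fin 2 → K}

theorem vecEval_chartVec (a : K) : vecEval (chartVec f e₁ e₂) a = evalVec f (e₁ + a • e₂) :=
  _root_.funext fun u => eval_chartMap e₁ e₂ a (f u)

theorem chartMap_linComb (c : Fin 3 → K) :
    chartMap e₁ e₂ (linComb f c) = ∑ u, Polynomial.C (c u) * chartVec f e₁ e₂ u := by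
  have hC : ∀ a : K, chartMap e₁ e₂ (C a) = Polynomial.C a := fun a => by simp [chartMap]
  simp only [linComb, map_sum, map_mul, hC, chartVec]

theorem coeff_chartMap_linComb (c : Fin 3 → K) (m : ℕ) :
    (chartMap e₁ e₂ (linComb f c)).coeff m = c ⬝ᵥ vecCoeff (chartVec f e₁ e₂) m := by
  simp [chartVec, Polynomial.finsetSum_coeff, vecCoeff, dotProduct]

theorem vecCoeff_chartVec (hf : ∀ u, (f u).IsHomogeneous (N + 2)) :
    vecCoeff (chartVec f e₁ e₂) (N + 2) = evalVec f e₂ :=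
  _root_.funext fun u => (chartMap_natDegree_le_and_coeff (hf u) e₁ e₂).2

theorem linFormOf_sq_dvd_linComb_iff (hf : ∀ u, (f u).IsHomogeneous (N + 2))
    (hδ : e₁ 1 * e₂ 0 - e₁ 0 * e₂ 1 ≠ 0) (a : K) (c : Fin 3 → K) :
    linFormOf (e₁ + a • e₂) ^ 2 ∣ linComb f c ↔ c ⬝ᵥ vecEval (chartVec f e₁ e₂) a = 0 ∧
      c ⬝ᵥ vecEval (vecDeriv (chartVec f e₁ e₂)) a = 0 := by
  rw [linFormOf_sq_dvd_iff (isHomogeneous_linComb hf c) hδ, eval_chartMap, eval_linComb,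
    vecEval_chartVec]
  refine and_congr_right fun _ => ?_
  simp [chartVec, Polynomial.eval_finsetSum, vecEval, vecDeriv, dotProduct]

theorem forall_add_smul_ne_smul (hδ : e₁ 1 * e₂ 0 - e₁ 0 * e₂ 1 ≠ 0) (a d : K) :
    e₁ + a • e₂ ≠ d • e₂ := fun h => by
  apply hδ
  have h0 := congrFun h 0
  have h1 := congrFun h 1
  simp at h0 h1
  linear_combination e₂ 0 * h1 - e₂ 1 * h0

theorem isImmersedChart_chartVec (hf : ∀ u, (f u).IsHomogeneous (N + 2))
    (hf0 : ∀ v : Fin 2 → K, v ≠ 0 → evalVec f v ≠ 0)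
    (hnd : ∀ c : Fin 3 → K, c ≠ 0 → linComb f c ≠ 0) (himm : IsImmersed f)
    (hδ : e₁ 1 * e₂ 0 - e₁ 0 * e₂ 1 ≠ 0)
    (hinfty : ∀ w : Fin 2 → K, w ≠ 0 → (∀ d : K, w ≠ d • e₂) → evalVec f e₂ ⨯₃ evalVec f w ≠ 0) :
    IsImmersedChart N (chartVec f e₁ e₂) where
  natDegree_le u := (chartMap_natDegree_le_and_coeff (hf u) e₁ e₂).1
  cross_infty a := by
    rw [vecCoeff_chartVec hf, vecEval_chartVec]
    exact hinfty _ (add_smul_ne_zero_of_det_ne_zero hδ a) (forall_add_smul_ne_smul hδ a)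
  cross_coeff h := by
    have he := ne_zero_of_det_ne_zero hδ
    rw [vecCoeff_chartVec hf] at h
    obtain ⟨l, hl⟩ := Polynomial.exists_eq_smul_of_cross_eq_zero (hf0 _ he) h
    refine himm e₂ he fun c hc => ?_
    refine linFormOf_infty_sq_dvd (isHomogeneous_linComb hf c) hδ ?_ ?_
    · rw [coeff_chartMap_linComb, vecCoeff_chartVec hf, hc]
    · rw [coeff_chartMap_linComb, show N + 2 - 1 = N + 1 by omega, hl, dotProduct_smul, hc,
        smul_zero]
  cross_deriv a h := by
    have he := add_smul_ne_zero_of_det_ne_zero hδ a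
    have h0 : vecEval (chartVec f e₁ e₂) a ≠ 0 := by
      rw [vecEval_chartVec]
      exact hf0 _ he
    obtain ⟨l, hl⟩ := Polynomial.exists_eq_smul_of_cross_eq_zero h0 h
    refine himm _ he fun c hc => ?_
    rw [← vecEval_chartVec] at hc
    rw [linFormOf_sq_dvd_linComb_iff hf hδ, hl, dotProduct_smul, hc]
    simp
  nondegenerate c h := by
    by_contra hc
    refine hnd c hc (chartMap_eq_zero (isHomogeneous_linComb hf c) hδ ?_)
    rw [chartMap_linComb]
    exact h

end Chart

section Counting
open scoped Matrix
open Polynomial (vecEval vecCoeff vecDeriv vecC IsImmersedChart)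
variable {K : Type*} [Field K] {N : ℕ} {f : Fin 3 → MvPolynomial (Fin 2) K} {e₁ e₂ : Fin 2 → K}

theorem det_add_smul (a b : K) :
    (e₁ + a • e₂) 1 * (e₁ + b • e₂) 0 - (e₁ + a • e₂) 0 * (e₁ + b • e₂) 1 =
      (b - a) * (e₁ 1 * e₂ 0 - e₁ 0 * e₂ 1) := by
  simp only [Pi.add_apply, Pi.smul_apply, smul_eq_mul]
  ring

theorem forall_ne_smul_of_det_ne_zero {v w : Fin 2 → K} (h : v 1 * w 0 - v 0 * w 1 ≠ 0) (d : K) :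
    w ≠ d • v := by
  rintro rfl
  apply h
  simp only [Pi.smul_apply, smul_eq_mul]
  ring

theorem mk_pairVec_add_smul_eq_iff (hδ : e₁ 1 * e₂ 0 - e₁ 0 * e₂ 1 ≠ 0) (a b a' b' : K) :
    Projectivization.mk K (pairVec (e₁ + a • e₂) (e₁ + b • e₂))
        (pairVec_ne_zero (add_smul_ne_zero_of_det_ne_zero hδ a)
          (add_smul_ne_zero_of_det_ne_zero hδ b)) =
      Projectivization.mk K (pairVec (e₁ + a' • e₂) (e₁ + b' • e₂))
        (pairVec_ne_zero (add_smul_ne_zero_of_det_ne_zero hδ a')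
          (add_smul_ne_zero_of_det_ne_zero hδ b')) ↔
      (a = a' ∧ b = b') ∨ (a = b' ∧ b = a') := by
  constructor
  · intro h
    obtain ⟨k, hk⟩ := (Projectivization.mk_eq_mk_iff' K _ _ _ _).1 h
    rw [← pairVec_smul_right] at hk
    have hform := congrArg (formOf 2) hk
    simp only [formOf_pairVec, linFormOf_smul] at hform
    have hk0 : k ≠ 0 := by
      rintro rfl
      rw [map_zero, zero_mul, mul_zero] at hform
      exact mul_ne_zero (linFormOf_ne_zero (add_smul_ne_zero_of_det_ne_zero hδ a))
        (linFormOf_ne_zero (add_smul_ne_zero_of_det_ne_zero hδ b)) hform.symm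
    have key : ∀ x, k * ((x - a') * (x - b')) = (x - a) * (x - b) := fun x => by
      have hx := congrArg (eval (e₁ + x • e₂)) hform
      simp only [map_mul, eval_C, eval_linFormOf, det_add_smul] at hx
      refine mul_right_cancel₀ (mul_ne_zero hδ hδ) ?_
      linear_combination hx
    have ha := key a
    have hb := key b
    have ha' := key a'
    have hb' := key b'
    simp only [sub_self, zero_mul, mul_zero, mul_eq_zero, hk0, false_or, zero_eq_mul] at ha hb ha' hb'
    simp only [sub_eq_zero] at ha hb ha' hb'
    grind
  · rintro (⟨rfl, rfl⟩ | ⟨rfl, rfl⟩)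
    · rfl
    · congr 1
      exact pairVec_comm _ _

theorem two_mul_ncard_XkSet [IsAlgClosed K] (hf : ∀ u, (f u).IsHomogeneous (N + 2))
    (hf0 : ∀ v : Fin 2 → K, v ≠ 0 → evalVec f v ≠ 0) (himm : IsImmersed f)
    (hδ : e₁ 1 * e₂ 0 - e₁ 0 * e₂ 1 ≠ 0)
    (hinfty : ∀ w : Fin 2 → K, w ≠ 0 → (∀ d : K, w ≠ d • e₂) → evalVec f e₂ ⨯₃ evalVec f w ≠ 0)
    (hfin : {q : K × K | q.2 ≠ q.1 ∧ vecEval (chartVec f e₁ e₂) q.1 ⨯₃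
      vecEval (chartVec f e₁ e₂) q.2 = 0}.Finite) :
    {q : K × K | q.2 ≠ q.1 ∧ vecEval (chartVec f e₁ e₂) q.1 ⨯₃
      vecEval (chartVec f e₁ e₂) q.2 = 0}.ncard = 2 * (XkSet (N + 2) 2 f).ncard := by
  classical
  have hne := add_smul_ne_zero_of_det_ne_zero hδ
  let g : K × K → Projectivization K (Fin 3 → K) := fun q =>
    Projectivization.mk K (pairVec (e₁ + q.1 • e₂) (e₁ + q.2 • e₂))
      (pairVec_ne_zero (hne q.1) (hne q.2))
  have hmem : ∀ q : K × K, q ∈ hfin.toFinset ↔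
      q.2 ≠ q.1 ∧ evalVec f (e₁ + q.1 • e₂) ⨯₃ evalVec f (e₁ + q.2 • e₂) = 0 := fun q => by
    rw [Set.Finite.mem_toFinset, Set.mem_ofPred_eq, vecEval_chartVec, vecEval_chartVec]
  have himage : XkSet (N + 2) 2 f = (hfin.toFinset.image g : Finset _) := by
    ext P
    rw [Finset.mem_coe, Finset.mem_image]
    constructor
    · intro hP
      obtain ⟨v, w, hv, hw, rfl⟩ := exists_eq_mk_pairVec P
      rw [mk_pairVec_mem_XkSet_iff hf hf0 hv hw] at hP
      have hvw : v 1 * w 0 - v 0 * w 1 ≠ 0 := fun h0 => by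
        obtain ⟨d, rfl⟩ := exists_smul_of_det_eq_zero hv h0
        refine himm v hv fun c hc => Dvd.dvd.trans ?_ (hP c hc)
        rw [linFormOf_smul, sq, mul_left_comm]
        exact dvd_mul_left _ _
      rw [linFormOf_mul_dvd_linComb_iff hf hvw (hf0 v hv)] at hP
      have hve : ∀ d : K, v ≠ d • e₂ := by
        rintro d rfl
        have hd : d ≠ 0 := by
          rintro rfl
          simp at hv
        rw [evalVec_smul hf, map_smul, LinearMap.smul_apply, smul_eq_zero] at hP
        refine hinfty w hw (fun c hc => hvw ?_) (hP.resolve_left (pow_ne_zero _ hd))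
        simp only [hc, Pi.smul_apply, smul_eq_mul]
        ring
      have hwe : ∀ d : K, w ≠ d • e₂ := by
        rintro d rfl
        have hd : d ≠ 0 := by
          rintro rfl
          simp at hw
        rw [← cross_anticomm, neg_eq_zero, evalVec_smul hf, map_smul, LinearMap.smul_apply,
          smul_eq_zero] at hP
        refine hinfty v hv (fun c hc => hvw ?_) (hP.resolve_left (pow_ne_zero _ hd))
        simp only [hc, Pi.smul_apply, smul_eq_mul]
        ring
      obtain ⟨d, a, hd, rfl⟩ := exists_eq_smul_add_smul hδ hve
      obtain ⟨d', b, hd', rfl⟩ := exists_eq_smul_add_smul hδ hwe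
      refine ⟨(a, b), (hmem _).2 ⟨?_, ?_⟩, ?_⟩
      · intro (hba : b = a)
        apply hvw
        simp only [hba, Pi.smul_apply, smul_eq_mul]
        ring
      · rw [evalVec_smul hf, evalVec_smul hf, map_smul, map_smul, LinearMap.smul_apply,
          smul_eq_zero, smul_eq_zero] at hP
        exact (hP.resolve_left (pow_ne_zero _ hd')).resolve_left (pow_ne_zero _ hd)
      · rw [Projectivization.mk_eq_mk_iff']
        refine ⟨(d' * d)⁻¹, ?_⟩
        rw [pairVec_smul_right, pairVec_comm, pairVec_smul_right, pairVec_comm, smul_smul d',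
          inv_smul_smul₀ (mul_ne_zero hd' hd)]
    · rintro ⟨⟨a, b⟩, hq, rfl⟩
      obtain ⟨hba, hcross⟩ := (hmem _).1 hq
      refine (mk_pairVec_mem_XkSet_iff hf hf0 (hne a) (hne b)).2 ?_
      refine (linFormOf_mul_dvd_linComb_iff hf ?_ (hf0 _ (hne a))).2 hcross
      rw [det_add_smul]
      exact mul_ne_zero (sub_ne_zero.2 hba) hδ
  rw [himage, Set.ncard_coe_finset, Set.ncard_eq_toFinset_card _ hfin]
  refine Finset.card_eq_two_mul_card_image (fun q hq => ?_) (fun q hq => ((hmem q).1 hq).1) ?_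
  · rw [hmem] at hq ⊢
    refine ⟨hq.1.symm, ?_⟩
    rw [← cross_anticomm, neg_eq_zero]
    exact hq.2
  · rintro ⟨a, b⟩ - ⟨a', b'⟩ -
    refine (mk_pairVec_add_smul_eq_iff hδ a' b' a b).trans ?_
    simp [Prod.ext_iff]

theorem hasDistinctTangents_iff (hf : ∀ u, (f u).IsHomogeneous (N + 2))
    (hf0 : ∀ v : Fin 2 → K, v ≠ 0 → evalVec f v ≠ 0)
    (hδ : e₁ 1 * e₂ 0 - e₁ 0 * e₂ 1 ≠ 0)
    (hinfty : ∀ w : Fin 2 → K, w ≠ 0 → (∀ d : K, w ≠ d • e₂) → evalVec f e₂ ⨯₃ evalVec f w ≠ 0)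
    (hchart : IsImmersedChart N (chartVec f e₁ e₂)) :
    HasDistinctTangents f ↔ ∀ a b : K, b ≠ a →
      vecEval (chartVec f e₁ e₂) a ⨯₃ vecEval (chartVec f e₁ e₂) b = 0 →
      (vecEval (chartVec f e₁ e₂) a ⨯₃ vecEval (vecDeriv (chartVec f e₁ e₂)) b) ⬝ᵥ
        vecEval (vecDeriv (chartVec f e₁ e₂)) a ≠ 0 := by
  have hne := add_smul_ne_zero_of_det_ne_zero hδ
  set φ := chartVec f e₁ e₂ with hφ
  have hφ0 : ∀ a, vecEval φ a ≠ 0 := fun a => by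
    rw [hφ, vecEval_chartVec]
    exact hf0 _ (hne a)
  constructor
  · intro htan a b hba hcross h0
    have hdet : (e₁ + a • e₂) 1 * (e₁ + b • e₂) 0 - (e₁ + a • e₂) 0 * (e₁ + b • e₂) 1 ≠ 0 := by
      rw [det_add_smul]
      exact mul_ne_zero (sub_ne_zero.2 hba) hδ
    obtain ⟨l, hl⟩ := Polynomial.exists_eq_smul_of_cross_eq_zero (hφ0 a) hcross
    have hm : vecEval φ a ⨯₃ vecEval (vecDeriv φ) b ≠ 0 := fun hm => by
      apply hchart.cross_deriv b
      rw [hl, map_smul, LinearMap.smul_apply, hm, smul_zero]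
    have hma : (vecEval φ a ⨯₃ vecEval (vecDeriv φ) b) ⬝ᵥ vecEval φ a = 0 := by
      rw [dotProduct_comm, dot_self_cross]
    refine htan _ _ (hne a) (hne b) (forall_ne_smul_of_det_ne_zero hdet) ?_ _ hm
      ((linFormOf_sq_dvd_linComb_iff hf hδ a _).2 ⟨hma, h0⟩)
      ((linFormOf_sq_dvd_linComb_iff hf hδ b _).2 ⟨?_, ?_⟩)
    · rw [← vecEval_chartVec, ← vecEval_chartVec]
      exact hcross
    · rw [← hφ, hl, dotProduct_smul, hma, smul_zero]
    · rw [dotProduct_comm, dot_cross_self]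
  · intro htr v w hv hw hvw hcross c hc hcv hcw
    have hve : ∀ d : K, v ≠ d • e₂ := by
      rintro d rfl
      have hd : d ≠ 0 := by
        rintro rfl
        simp at hv
      rw [evalVec_smul hf, map_smul, LinearMap.smul_apply, smul_eq_zero] at hcross
      refine hinfty w hw (fun k hk => hvw (k * d⁻¹) ?_)
        (hcross.resolve_left (pow_ne_zero _ hd))
      rw [hk, smul_smul, inv_mul_cancel_right₀ hd]
    have hwe : ∀ d : K, w ≠ d • e₂ := by
      rintro d rfl
      have hd : d ≠ 0 := by
        rintro rfl
        simp at hw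
      rw [← cross_anticomm, neg_eq_zero, evalVec_smul hf, map_smul, LinearMap.smul_apply,
        smul_eq_zero] at hcross
      exact hinfty v hv hve (hcross.resolve_left (pow_ne_zero _ hd))
    obtain ⟨d, a, hd, rfl⟩ := exists_eq_smul_add_smul hδ hve
    obtain ⟨d', b, hd', rfl⟩ := exists_eq_smul_add_smul hδ hwe
    have hsq : ∀ (k x : K), k ≠ 0 → linFormOf (k • (e₁ + x • e₂)) ^ 2 ∣ linComb f c →
        c ⬝ᵥ vecEval φ x = 0 ∧ c ⬝ᵥ vecEval (vecDeriv φ) x = 0 := fun k x hk h => by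
      refine (linFormOf_sq_dvd_linComb_iff hf hδ x c).1 (Dvd.dvd.trans ?_ h)
      rw [linFormOf_smul, mul_pow]
      exact dvd_mul_left _ _
    obtain ⟨hca, hca'⟩ := hsq d a hd hcv
    obtain ⟨hcb, hcb'⟩ := hsq d' b hd' hcw
    rw [evalVec_smul hf, evalVec_smul hf, map_smul, map_smul, LinearMap.smul_apply,
      smul_eq_zero, smul_eq_zero] at hcross
    have hcross' : vecEval φ a ⨯₃ vecEval φ b = 0 := by
      rw [hφ, vecEval_chartVec, vecEval_chartVec]
      exact (hcross.resolve_left (pow_ne_zero _ hd')).resolve_left (pow_ne_zero _ hd)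
    have hcm : c ⨯₃ (vecEval φ a ⨯₃ vecEval (vecDeriv φ) b) = 0 := by
      rw [cross_cross_eq_smul_sub_smul', hcb', dotProduct_comm (vecEval φ a) c, hca]
      simp
    obtain ⟨l, hl⟩ := Polynomial.exists_eq_smul_of_cross_eq_zero hc hcm
    refine htr a b ?_ hcross' (by rw [hl, smul_dotProduct, hca', smul_zero])
    rintro rfl
    refine hvw (d' * d⁻¹) ?_
    rw [smul_smul, inv_mul_cancel_right₀ hd]

theorem ncard_XkSet_eq_iff [IsAlgClosed K] (hf : IsProperParam (N + 2) f)
    (hnd : ∀ c : Fin 3 → K, c ≠ 0 → linComb f c ≠ 0) (himm : IsImmersed f) :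
    (XkSet (N + 2) 2 f).ncard = (N + 1) * N / 2 ↔ HasDistinctTangents f := by
  obtain ⟨S, hSfin, hS⟩ := hf.gen_injective
  have : Infinite K := IsAlgClosed.instInfinite
  obtain ⟨τ, hτ⟩ := exists_forall_cross_ne_zero hf.homog hf.no_common_zero hnd hSfin hS
  have hδ : (![0, 1] : Fin 2 → K) 1 * (![1, τ] : Fin 2 → K) 0 -
      (![0, 1] : Fin 2 → K) 0 * (![1, τ] : Fin 2 → K) 1 ≠ 0 := by simp
  have hchart := isImmersedChart_chartVec hf.homog hf.no_common_zero hnd himm hδ hτ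
  obtain ⟨hfin, hiff⟩ := hchart.finite_and_ncard_eq_iff
  rw [hasDistinctTangents_iff hf.homog hf.no_common_zero hδ hτ hchart, ← hiff,
    two_mul_ncard_XkSet hf.homog hf.no_common_zero himm hδ hτ hfin]
  obtain ⟨m, hm⟩ := Nat.even_mul_succ_self N
  rw [mul_comm] at hm
  omega

end Counting

/-- `C` has only ordinary singularities if and only if `X_2(K)` consists of exactly
`(n-1)(n-2)/2` points and none of them lies on the conic `4x_0x_2 - x_1² = 0`. -/
theorem statement_6 {K : Type*} [Field K] [IsAlgClosed K] [CharZero K]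
    (n : ℕ) (hn : 3 ≤ n) (f : Fin 3 → MvPolynomial (Fin 2) K)
    (hf : IsProperParam n f)
    (F : MvPolynomial (Fin 3) K) (hFirr : Irreducible F) (hFhom : F.IsHomogeneous n)
    (hFf : MvPolynomial.aeval f F = 0) :
    OnlyOrdinarySing f F ↔
      ((XkSet n 2 f).ncard = (n - 1) * (n - 2) / 2 ∧
        ∀ P ∈ XkSet n 2 f, ¬ onConic (Projectivization.rep P)) := by
  obtain ⟨N, rfl⟩ : ∃ N, n = N + 2 := ⟨n - 2, by omega⟩
  have hnd : ∀ c : Fin 3 → K, c ≠ 0 → linComb f c ≠ 0 := fun c hc =>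
    linComb_ne_zero hn hf.homog hf.no_common_zero hFirr hFhom hFf hc
  rw [onlyOrdinarySing_iff hf.homog hf.no_common_zero hnd fun p q hp hq h =>
      two_le_multAt (by omega) hf.homog hf.no_common_zero hFirr hFhom hFf hp hq h,
    forall_not_onConic_iff hf.homog hf.no_common_zero, and_comm,
    show N + 2 - 1 = N + 1 by omega, show N + 2 - 2 = N by omega]
  exact and_congr_left fun himm => (ncard_XkSet_eq_iff hf hnd himm).symm

end
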